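/- For every finite group G one has 𝒮_G ⊆ 𝒫_G, i.e. every permutation character of G of degree 0 and trivial determinant lies in 𝒫_G. -/

import Mathlib

open scoped Classical

noncomputable section

/-- The complex conjugate of a complex-valued function. -/
def conjFun {G : Type} (f : G → ℂ) : G → ℂ := fun g => starRingEnd ℂ (f g)

/-- Induction of class functions from a subgroup `H` of `G` to `G`. -/
def indChar {G : Type} [Group G] [Fintype G] (H : Subgroup G) (f : ↥H → ℂ) : G → ℂ :=
  fun g => (Nat.card H : ℂ)⁻¹ *
    ∑ x : G, if h : x⁻¹ * g * x ∈ H then f ⟨x⁻¹ * g * x, h⟩ else 0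

/-- The determinant (linear) character of a finite-dimensional complex representation. -/
def detRep {G : Type} [Group G] (V : FDRep ℂ G) : G → ℂ := fun g => LinearMap.det (V.ρ g)

/-- `f` is the character of some finite-dimensional complex representation of `G`. -/
def IsChar {G : Type} [Group G] (f : G → ℂ) : Prop := ∃ V : FDRep ℂ G, V.character = f

/-- A generalised (virtual) character: a `ℤ`-linear combination of characters. -/
def IsGenChar {G : Type} [Group G] (f : G → ℂ) : Prop :=
  f ∈ Submodule.span ℤ {f : G → ℂ | IsChar f}

/-- A generalised character has trivial determinant: writing `f = χ_V - χ_W`,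
`det V ⊗ conj (det W)` is the trivial character. -/
def HasTrivialDet {G : Type} [Group G] (f : G → ℂ) : Prop :=
  ∃ V W : FDRep ℂ G, f = V.character - W.character ∧
    ∀ g, detRep V g * starRingEnd ℂ (detRep W g) = 1

/-- A permutation character: a `ℤ`-linear combination of characters `Ind_H^G 1_H`. -/
def IsPermChar {G : Type} [Group G] [Fintype G] (f : G → ℂ) : Prop :=
  f ∈ Submodule.span ℤ {f : G → ℂ | ∃ H : Subgroup G, f = indChar H 1}

/-- `𝒮_G`: permutation characters of `G` of degree `0` and trivial determinant. -/
def SG (G : Type) [Group G] [Fintype G] : Set (G → ℂ) :=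
  {f | IsPermChar f ∧ f 1 = 0 ∧ HasTrivialDet f}

/-- `Q` is isomorphic to `C₂ × C₂`, to `D₈`, or to `D_{2p}` for an odd prime `p`
(`DihedralGroup m` is the dihedral group of order `2m`). -/
def IsTargetGroup (Q : Type) [Group Q] : Prop :=
  Nonempty (Q ≃* Multiplicative (ZMod 2 × ZMod 2)) ∨ Nonempty (Q ≃* DihedralGroup 4) ∨
    ∃ p : ℕ, Odd p ∧ p.Prime ∧ Nonempty (Q ≃* DihedralGroup p)

/-- `𝒫_G`: the smallest set of generalised characters of `G` containing `τ + τ̄` for every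
generalised character `τ` of degree 0, containing `Ind_H^G (τ - 1 - det τ)` for every degree-2
character `τ` of a subgroup `H` factoring through a quotient of `H` isomorphic to `C₂ × C₂`,
`D₈` or `D_{2p}` (`p` an odd prime), and closed under `ℤ`-linear combinations. -/
inductive memP (G : Type) [Group G] [Fintype G] : (G → ℂ) → Prop
  | conj_add (τ : G → ℂ) (hτ : IsGenChar τ) (hdeg : τ 1 = 0) : memP G (τ + conjFun τ)
  | ind (H : Subgroup G) (N : Subgroup ↥H) [hN : N.Normal] (V : FDRep ℂ ↥H)
      (hdeg : V.character 1 = 2) (htarget : IsTargetGroup (↥H ⧸ N))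
      (hfactors : ∀ n : ↥H, n ∈ N → V.ρ n = 1) :
      memP G (indChar H (V.character - 1 - detRep V))
  | zero : memP G 0
  | add (f₁ f₂ : G → ℂ) (h₁ : memP G f₁) (h₂ : memP G f₂) : memP G (f₁ + f₂)
  | neg (f : G → ℂ) (h : memP G f) : memP G (-f)

/-- `𝒫_G` as a set. -/
def PG (G : Type) [Group G] [Fintype G] : Set (G → ℂ) := {f | memP G f}

end

namespace PermChar

noncomputable section

section Basic

variable {G : Type} [Group G]

/-- The representation on `ι → ℂ` given by a matrix representation. -/
def matRep {ι : Type} [Fintype ι] [DecidableEq ι] (R : G →* Matrix ι ι ℂ) : FDRep ℂ G :=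
  FDRep.of (V := ι → ℂ)
    (((Matrix.toLinAlgEquiv' : Matrix ι ι ℂ ≃ₐ[ℂ] ((ι → ℂ) →ₗ[ℂ] (ι → ℂ))) :
      Matrix ι ι ℂ →* ((ι → ℂ) →ₗ[ℂ] (ι → ℂ))).comp R)

theorem matRep_ρ {ι : Type} [Fintype ι] [DecidableEq ι] (R : G →* Matrix ι ι ℂ) (g : G) :
    (matRep R).ρ g = Matrix.toLin' (R g) := rfl

theorem matRep_character {ι : Type} [Fintype ι] [DecidableEq ι] (R : G →* Matrix ι ι ℂ) (g : G) :
    (matRep R).character g = (R g).trace :=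
  Matrix.trace_toLin'_eq (R g)

theorem matRep_detRep {ι : Type} [Fintype ι] [DecidableEq ι] (R : G →* Matrix ι ι ℂ) (g : G) :
    detRep (matRep R) g = (R g).det :=
  LinearMap.det_toLin' (R g)

theorem isChar_trace {ι : Type} [Fintype ι] [DecidableEq ι] (R : G →* Matrix ι ι ℂ) :
    IsChar fun g => (R g).trace :=
  ⟨matRep R, funext (matRep_character R)⟩

theorem _root_.IsChar.exists_matrix {f : G → ℂ} (hf : IsChar f) :
    ∃ (n : ℕ) (R : G →* Matrix (Fin n) (Fin n) ℂ), f = fun g => (R g).trace := by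
  obtain ⟨V, rfl⟩ := hf
  let b := Module.finBasis ℂ V
  refine ⟨_, ((LinearMap.toMatrixAlgEquiv b).toRingEquiv.toMulEquiv.toMonoidHom).comp V.ρ,
    funext fun g => ?_⟩
  exact LinearMap.trace_eq_matrix_trace ℂ b (V.ρ g)

theorem _root_.IsChar.isGenChar {f : G → ℂ} (hf : IsChar f) : IsGenChar f :=
  Submodule.subset_span hf

theorem _root_.IsGenChar.sub {f g : G → ℂ} (hf : IsGenChar f) (hg : IsGenChar g) :
    IsGenChar (f - g) :=
  Submodule.sub_mem _ hf hg

theorem isGenChar_linear (χ : G →* ℂ) : IsGenChar (χ : G → ℂ) := by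
  let R : G →* Matrix Unit Unit ℂ := ((Matrix.scalar Unit : ℂ →+* _) : ℂ →* _).comp χ
  have h : (χ : G → ℂ) = fun g => (R g).trace := by
    funext g
    simp [R, Matrix.trace]
  rw [h]
  exact (isChar_trace R).isGenChar

theorem isGenChar_one : IsGenChar (1 : G → ℂ) :=
  isGenChar_linear (1 : G →* ℂ)

theorem _root_.IsGenChar.intCast_mul {f : G → ℂ} (hf : IsGenChar f) (n : ℤ) :
    IsGenChar fun g => (n : ℂ) * f g := by
  have := Submodule.smul_mem _ n hf
  have h : (fun g => (n : ℂ) * f g) = n • f := by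
    funext g
    simp
  rw [h]
  exact this

theorem isGenChar_intCast (n : ℤ) : IsGenChar (fun _ : G => (n : ℂ)) := by
  simpa using isGenChar_one.intCast_mul (G := G) n

end Basic

section ExtendZero

variable {G : Type} [Group G]

/-- Extension by zero of a function on a subgroup. -/
def extendZero (H : Subgroup G) (f : H → ℂ) (y : G) : ℂ := if h : y ∈ H then f ⟨y, h⟩ else 0

theorem extendZero_of_mem {H : Subgroup G} (f : H → ℂ) {y : G} (h : y ∈ H) :
    extendZero H f y = f ⟨y, h⟩ := dif_pos h

theorem extendZero_of_notMem {H : Subgroup G} (f : H → ℂ) {y : G} (h : y ∉ H) :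
    extendZero H f y = 0 := dif_neg h

theorem extendZero_add (H : Subgroup G) (f f' : H → ℂ) (y : G) :
    extendZero H (f + f') y = extendZero H f y + extendZero H f' y := by
  unfold extendZero; split_ifs <;> simp

theorem extendZero_conj (H : Subgroup G) (f : H → ℂ) (y : G) :
    extendZero H (conjFun f) y = starRingEnd ℂ (extendZero H f y) := by
  unfold extendZero; split_ifs <;> simp [conjFun]

/-- The cocycle describing the action of `G` on `G ⧸ H` lifted to representatives. -/
def cocycle (H : Subgroup G) (g : G) (b : G ⧸ H) : H :=
  ⟨(g • b).out⁻¹ * g * b.out, by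
    rw [mul_assoc, ← QuotientGroup.eq]
    rw [QuotientGroup.out_eq', ← smul_eq_mul, ← MulAction.Quotient.smul_mk, QuotientGroup.out_eq']⟩

theorem cocycle_mul (H : Subgroup G) (g g' : G) (b : G ⧸ H) :
    cocycle H (g * g') b = cocycle H g (g' • b) * cocycle H g' b := by
  ext
  simp [cocycle, mul_smul, mul_assoc]

theorem cocycle_one (H : Subgroup G) (b : G ⧸ H) : cocycle H 1 b = 1 := by
  ext
  simp [cocycle]

end ExtendZero

section Induction

variable {G : Type} [Group G] [Fintype G]

theorem indChar_apply (H : Subgroup G) (f : H → ℂ) (g : G) :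
    indChar H f g = (Nat.card H : ℂ)⁻¹ * ∑ x : G, extendZero H f (x⁻¹ * g * x) := rfl

/-- Induction of functions as an additive homomorphism. -/
def indHom (H : Subgroup G) : (H → ℂ) →+ (G → ℂ) where
  toFun := indChar H
  map_zero' := by
    funext g
    simp [indChar]
  map_add' f f' := by
    funext g
    simp only [indChar_apply, Pi.add_apply, extendZero_add, Finset.sum_add_distrib, mul_add]

theorem indHom_apply (H : Subgroup G) (f : H → ℂ) : indHom H f = indChar H f := rfl

theorem indChar_conj (H : Subgroup G) (f : H → ℂ) :
    indChar H (conjFun f) = conjFun (indChar H f) := by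
  funext g
  simp [indChar_apply, conjFun, extendZero_conj]

theorem indChar_eq_of_left_invariant (H : Subgroup G) (F : G → ℂ)
    (hF : ∀ x : G, ∀ m ∈ H, F (x * m) = F x) :
    (Nat.card H : ℂ)⁻¹ * ∑ x : G, F x = ∑ b : G ⧸ H, F b.out := by
  have h1 : ∑ x : G, F x = ∑ p : (G ⧸ H) × H, F p.1.out := by
    refine Fintype.sum_equiv Subgroup.groupEquivQuotientProdSubgroup _ _ fun x => ?_
    have h2 : (Subgroup.groupEquivQuotientProdSubgroup (s := H) x).1 = (x : G ⧸ H) := rfl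
    rw [h2]
    have h3 := QuotientGroup.mk_out_eq_mul H x
    obtain ⟨h, hh⟩ := h3
    rw [hh, hF _ _ h.2]
  rw [h1, Fintype.sum_prod_type]
  have : (Nat.card H : ℂ) ≠ 0 := by exact_mod_cast Nat.card_pos.ne'
  simp only [Finset.sum_const, Finset.card_univ, nsmul_eq_mul, ← Nat.card_eq_fintype_card]
  rw [← Finset.mul_sum, inv_mul_cancel_left₀ this]

/-- The induced matrix representation. -/
def indMat (H : Subgroup G) {ι : Type} [Fintype ι] [DecidableEq ι] (R : H →* Matrix ι ι ℂ) :
    G →* Matrix ((G ⧸ H) × ι) ((G ⧸ H) × ι) ℂ where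
  toFun g := Matrix.of fun p q => if p.1 = g • q.1 then R (cocycle H g q.1) p.2 q.2 else 0
  map_one' := by
    ext ⟨b, i⟩ ⟨c, j⟩
    simp only [Matrix.of_apply, one_smul, cocycle_one, map_one, Matrix.one_apply, Prod.mk.injEq]
    split_ifs <;> simp_all
  map_mul' g g' := by
    ext ⟨b, i⟩ ⟨c, j⟩
    rw [Matrix.mul_apply, Fintype.sum_prod_type]
    simp only [Matrix.of_apply, cocycle_mul, map_mul, mul_smul]
    rw [Finset.sum_eq_single (g' • c)]
    · simp only [if_true]
      split_ifs with h
      · exact Matrix.mul_apply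
      · simp
    · intro d _ hd
      simp [hd]
    · simp

theorem _root_.IsChar.indChar (H : Subgroup G) {f : H → ℂ} (hf : IsChar f) :
    IsChar (indChar H f) := by
  obtain ⟨n, R, rfl⟩ := hf.exists_matrix
  convert isChar_trace (indMat H R) using 1
  funext g
  rw [indChar_apply, indChar_eq_of_left_invariant H]
  · simp only [Matrix.trace, Matrix.diag, Fintype.sum_prod_type, indMat, MonoidHom.coe_mk,
      OneHom.coe_mk, Matrix.of_apply]
    refine Finset.sum_congr rfl fun b _ => ?_
    have key : b.out⁻¹ * g * b.out ∈ H ↔ b = g • b := by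
      rw [mul_assoc, ← QuotientGroup.eq, ← smul_eq_mul, ← MulAction.Quotient.smul_mk,
        QuotientGroup.out_eq']
    split_ifs with h
    · rw [extendZero_of_mem _ (key.2 h)]
      have : cocycle H g b = ⟨b.out⁻¹ * g * b.out, key.2 h⟩ := by
        ext
        simp only [cocycle]
        rw [← h]
      rw [this]
    · rw [extendZero_of_notMem _ (fun h' => h (key.1 h'))]
      simp
  · intro x m hm
    have h1 : (x * m)⁻¹ * g * (x * m) = m⁻¹ * (x⁻¹ * g * x) * m := by group
    rw [h1]
    by_cases h : x⁻¹ * g * x ∈ H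
    · have h2 : m⁻¹ * (x⁻¹ * g * x) * m ∈ H := H.mul_mem (H.mul_mem (H.inv_mem hm) h) hm
      rw [extendZero_of_mem _ h, extendZero_of_mem _ h2]
      have : (⟨m⁻¹ * (x⁻¹ * g * x) * m, h2⟩ : H) = ⟨m, hm⟩⁻¹ * ⟨_, h⟩ * ⟨m, hm⟩ := rfl
      rw [this, map_mul, map_mul, Matrix.trace_mul_comm, ← mul_assoc, ← map_mul]
      simp
    · rw [extendZero_of_notMem _ h, extendZero_of_notMem]
      intro h2
      apply h
      have := H.mul_mem (H.mul_mem hm h2) (H.inv_mem hm)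
      simpa [mul_assoc] using this

theorem _root_.IsGenChar.indChar (H : Subgroup G) {f : H → ℂ} (hf : IsGenChar f) :
    IsGenChar (indChar H f) := by
  unfold IsGenChar at hf ⊢
  rw [← Submodule.mem_toAddSubgroup, Submodule.span_int_eq_addSubgroupClosure] at hf ⊢
  have : AddSubgroup.closure {f : H → ℂ | IsChar f} ≤
      (AddSubgroup.closure {f : G → ℂ | IsChar f}).comap (indHom H) := by
    rw [AddSubgroup.closure_le]
    intro f hf
    exact AddSubgroup.subset_closure (IsChar.indChar H hf)
  exact this hf

theorem indChar_trans (M : Subgroup G) (H : Subgroup M) (f : H → ℂ)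
    (e : H.map M.subtype ≃* H) (he : ∀ x, ((e x : M) : G) = x) :
    indChar M (indChar H f) = indChar (H.map M.subtype) (f ∘ e) := by
  funext g
  have hcard : Nat.card (H.map M.subtype) = Nat.card H := Nat.card_congr e.toEquiv
  have hM : (Nat.card M : ℂ) ≠ 0 := by exact_mod_cast Nat.card_pos.ne'
  have key : ∀ z : G, extendZero M (indChar H f) z =
      (Nat.card H : ℂ)⁻¹ * ∑ y : M, extendZero (H.map M.subtype) (f ∘ e) ((y : G)⁻¹ * z * y) := by
    intro z
    by_cases hz : z ∈ M
    · rw [extendZero_of_mem _ hz, indChar_apply]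
      congr 1
      refine Finset.sum_congr rfl fun y _ => ?_
      by_cases h : y⁻¹ * ⟨z, hz⟩ * y ∈ H
      · have h' : (y : G)⁻¹ * z * y ∈ H.map M.subtype := ⟨_, h, rfl⟩
        rw [extendZero_of_mem _ h, extendZero_of_mem _ h', Function.comp]
        congr 1
        apply Subtype.ext
        apply Subtype.ext
        exact (he ⟨_, h'⟩).symm
      · rw [extendZero_of_notMem _ h, extendZero_of_notMem]
        rintro ⟨w, hw, hw'⟩
        apply h
        have hyw : y⁻¹ * ⟨z, hz⟩ * y = w := Subtype.ext hw'.symm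
        rw [hyw]
        exact hw
    · rw [extendZero_of_notMem _ hz, Finset.sum_eq_zero, mul_zero]
      intro y _
      apply extendZero_of_notMem
      rintro ⟨w, hw, hw'⟩
      apply hz
      have : z = y * w * y⁻¹ := by
        simp only [Subgroup.subtype_apply] at hw'
        rw [hw']; simp [mul_assoc]
      rw [this]
      exact M.mul_mem (M.mul_mem y.2 w.2) (M.inv_mem y.2)
  rw [indChar_apply, indChar_apply, hcard]
  simp only [key]
  rw [← Finset.mul_sum, Finset.sum_comm]
  have : ∀ y : M, ∑ x : G, extendZero (H.map M.subtype) (f ∘ e) ((y : G)⁻¹ * (x⁻¹ * g * x) * y) =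
      ∑ x : G, extendZero (H.map M.subtype) (f ∘ e) (x⁻¹ * g * x) := by
    intro y
    refine Fintype.sum_equiv (Equiv.mulRight (y : G)) _ _ fun x => ?_
    congr 1
    simp only [Equiv.coe_mulRight]
    group
  simp only [this, Finset.sum_const, Finset.card_univ, nsmul_eq_mul, ← Nat.card_eq_fintype_card]
  field_simp

end Induction

section MemP

variable {G : Type} [Group G] [Fintype G]

variable (G) in
/-- `𝒫_G` as an additive subgroup. -/
def P : AddSubgroup (G → ℂ) where
  carrier := {f | memP G f}
  add_mem' := memP.add _ _
  zero_mem' := memP.zero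
  neg_mem' := memP.neg _

theorem mem_P {f : G → ℂ} : f ∈ P G ↔ memP G f := Iff.rfl

theorem indChar_mem_P (M : Subgroup G) {f : M → ℂ} (hf : f ∈ P M) : indChar M f ∈ P G := by
  rw [mem_P] at hf
  induction hf with
  | conj_add τ hτ hdeg =>
    rw [← indHom_apply, map_add, indHom_apply, indHom_apply, indChar_conj]
    refine memP.conj_add _ (IsGenChar.indChar M hτ) ?_
    rw [indChar_apply, Finset.sum_eq_zero, mul_zero]
    intro x _
    simp only [mul_one, inv_mul_cancel]
    rw [extendZero_of_mem _ M.one_mem]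
    exact hdeg
  | ind H N V hdeg htarget hfactors =>
    let e : H.map M.subtype ≃* H := (H.equivMapOfInjective M.subtype M.subtype_injective).symm
    have he : ∀ x, ((e x : M) : G) = x := by
      intro x
      obtain ⟨y, rfl⟩ := (H.equivMapOfInjective M.subtype M.subtype_injective).surjective x
      simp [e]
    rw [indChar_trans M H _ e he]
    let V' : FDRep ℂ (H.map M.subtype) := FDRep.of (V.ρ.comp (e : _ →* _))
    have hV : (V.character - 1 - detRep V) ∘ e = V'.character - 1 - detRep V' := rfl
    rw [hV]
    let N' : Subgroup (H.map M.subtype) := N.comap (e : _ →* _)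
    have : N'.Normal := inferInstance
    have hmap : N'.map (e : _ →* _) = N :=
      Subgroup.map_comap_eq_self_of_surjective e.surjective N
    let q : (H.map M.subtype) ⧸ N' ≃* H ⧸ N := QuotientGroup.congr N' N e hmap
    refine memP.ind (H.map M.subtype) N' V' ?_ ?_ ?_
    · have : V'.character 1 = V.character (e 1) := rfl
      rw [this, map_one, hdeg]
    · rcases htarget with ⟨⟨i⟩⟩ | ⟨⟨i⟩⟩ | ⟨p, hp, hp', ⟨i⟩⟩
      · exact Or.inl ⟨q.trans i⟩
      · exact Or.inr (Or.inl ⟨q.trans i⟩)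
      · exact Or.inr (Or.inr ⟨p, hp, hp', ⟨q.trans i⟩⟩)
    · intro n hn
      exact hfactors (e n) hn
  | zero =>
    rw [← indHom_apply, map_zero]
    exact (P G).zero_mem
  | add f₁ f₂ _ _ h₁ h₂ =>
    rw [← indHom_apply, map_add]
    exact (P G).add_mem h₁ h₂
  | neg f _ h =>
    rw [← indHom_apply, map_neg]
    exact (P G).neg_mem h

theorem indChar_dihedral_mem_P (H : Subgroup G) {Q : Type} [Group Q] (hQ : IsTargetGroup Q)
    (φ : H →* Q) (hφ : Function.Surjective φ) (R : Q →* Matrix (Fin 2) (Fin 2) ℂ) :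
    indChar H (fun h => (R (φ h)).trace - 1 - (R (φ h)).det) ∈ P G := by
  have h1 : (fun h => (R (φ h)).trace - 1 - (R (φ h)).det) =
      (matRep (R.comp φ)).character - 1 - detRep (matRep (R.comp φ)) := by
    funext h
    simp [matRep_character, matRep_detRep]
  rw [h1]
  let q : H ⧸ φ.ker ≃* Q := QuotientGroup.quotientKerEquivOfSurjective φ hφ
  refine memP.ind H φ.ker _ ?_ ?_ ?_
  · rw [matRep_character]
    simp
  · rcases hQ with ⟨⟨i⟩⟩ | ⟨⟨i⟩⟩ | ⟨p, hp, hp', ⟨i⟩⟩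
    · exact Or.inl ⟨q.trans i⟩
    · exact Or.inr (Or.inl ⟨q.trans i⟩)
    · exact Or.inr (Or.inr ⟨p, hp, hp', ⟨q.trans i⟩⟩)
  · intro n hn
    rw [MonoidHom.mem_ker] at hn
    rw [matRep_ρ, MonoidHom.comp_apply, hn, map_one]
    exact Matrix.toLin'_one

theorem indChar_top (f : G → ℂ) (hf : ∀ x g, f (x⁻¹ * g * x) = f g) :
    indChar (⊤ : Subgroup G) (fun h => f h) = f := by
  funext g
  have : ∀ x : G, extendZero (⊤ : Subgroup G) (fun h => f h) (x⁻¹ * g * x) = f g := fun x => by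
    rw [extendZero_of_mem _ (Subgroup.mem_top _), hf]
  rw [indChar_apply]
  have hG : (Nat.card G : ℂ) ≠ 0 := by exact_mod_cast Nat.card_pos.ne'
  simp only [this, Finset.sum_const, Finset.card_univ, nsmul_eq_mul, ← Nat.card_eq_fintype_card]
  rw [Subgroup.card_top, inv_mul_cancel_left₀ hG]

theorem dihedral_mem_P {Q : Type} [Group Q] (hQ : IsTargetGroup Q)
    (φ : G →* Q) (hφ : Function.Surjective φ) (R : Q →* Matrix (Fin 2) (Fin 2) ℂ) :
    (fun g => (R (φ g)).trace - 1 - (R (φ g)).det) ∈ P G := by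
  rw [← indChar_top (fun g => (R (φ g)).trace - 1 - (R (φ g)).det)]
  · refine indChar_dihedral_mem_P ⊤ hQ (φ.comp (⊤ : Subgroup G).subtype) ?_ R
    intro y
    obtain ⟨x, rfl⟩ := hφ y
    exact ⟨⟨x, Subgroup.mem_top x⟩, rfl⟩
  · intro x g
    have h : ∀ z : G, φ (x⁻¹ * z * x) = (φ x)⁻¹ * φ z * φ x := fun z => by simp
    have h1 : R (φ x) * R ((φ x)⁻¹) = 1 := by rw [← map_mul]; simp
    simp only [h, map_mul, Matrix.det_mul]
    rw [Matrix.trace_mul_comm, ← mul_assoc, h1, one_mul]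
    have h2 := congrArg Matrix.det h1
    rw [Matrix.det_mul, Matrix.det_one] at h2
    linear_combination (-(R (φ g)).det) * h2

/-- Twice a real generalised character of degree zero lies in `𝒫_G`. -/
theorem two_mul_mem_P {f : G → ℂ} (hf : IsGenChar f) (h1 : f 1 = 0)
    (hreal : ∀ g, starRingEnd ℂ (f g) = f g) : (fun g => 2 * f g) ∈ P G := by
  have := memP.conj_add f hf h1
  have h : (fun g => 2 * f g) = f + conjFun f := by
    funext g
    simp [conjFun, hreal, two_mul]
  rw [h]
  exact this

end MemP

section Linear

variable {G : Type} [Group G]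

/-- The degree-zero generalised character `ε - 1` attached to a quadratic character `ε`. -/
def lin (ε : G →* ℤˣ) (g : G) : ℂ := ((ε g : ℤ) : ℂ) - 1

/-- Quadratic characters as complex linear characters. -/
def toComplexChar (ε : G →* ℤˣ) : G →* ℂ :=
  ((Int.castRingHom ℂ : ℤ →* ℂ).comp (Units.coeHom ℤ)).comp ε

theorem isGenChar_lin (ε : G →* ℤˣ) : IsGenChar (lin ε) :=
  (isGenChar_linear (toComplexChar ε)).sub isGenChar_one

variable [Fintype G]

theorem units_surjective_aux : ∀ x y z : ℤˣ × ℤˣ, x.1 = -1 → y.2 = -1 → z.1 ≠ z.2 →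
    ∀ w, ∃ i j k : Fin 2, w = x ^ (i : ℕ) * y ^ (j : ℕ) * z ^ (k : ℕ) := by
  decide

theorem two_nsmul_lin_mem_P (ε : G →* ℤˣ) : (2 : ℕ) • lin ε ∈ P G := by
  have := two_mul_mem_P (isGenChar_lin ε) (by simp [lin]) (by simp [lin])
  have h : (2 : ℕ) • lin ε = fun g => 2 * lin ε g := by
    funext g
    simp
  rwa [h]

theorem isTargetGroup_units_prod : IsTargetGroup (ℤˣ × ℤˣ) := by
  have e : ℤˣ ≃* Multiplicative (ZMod 2) :=
    mulEquivOfPrimeCardEq (p := 2) (by simp) (by simp)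
  exact Or.inl ⟨(MulEquiv.prodCongr e e).trans (MulEquiv.prodMultiplicative _ _).symm⟩

/-- The two-dimensional diagonal representation of `ℤˣ × ℤˣ`. -/
def diagRep : ℤˣ × ℤˣ →* Matrix (Fin 2) (Fin 2) ℂ where
  toFun x := !![((x.1 : ℤ) : ℂ), 0; 0, ((x.2 : ℤ) : ℂ)]
  map_one' := by
    ext i j
    fin_cases i <;> fin_cases j <;> simp
  map_mul' x y := by
    simp

theorem lin_mul_mem_P (a b : G →* ℤˣ) : lin a + lin b - lin (a * b) ∈ P G := by
  have hfun : lin a + lin b - lin (a * b) =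
      fun g => ((a g : ℤ) : ℂ) + ((b g : ℤ) : ℂ) - 1 - ((a g : ℤ) : ℂ) * ((b g : ℤ) : ℂ) := by
    funext g
    simp [lin]
    ring
  by_cases ha : ∀ g, a g = 1
  · have : lin a + lin b - lin (a * b) = 0 := by
      rw [hfun]
      funext g
      simp [ha]
    rw [this]
    exact (P G).zero_mem
  by_cases hb : ∀ g, b g = 1
  · have : lin a + lin b - lin (a * b) = 0 := by
      rw [hfun]
      funext g
      simp [hb]
    rw [this]
    exact (P G).zero_mem
  by_cases hab : ∀ g, a g = b g
  · have : lin a + lin b - lin (a * b) = (2 : ℕ) • lin a := by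
      rw [hfun]
      funext g
      have : ((a g : ℤ) : ℂ) * ((a g : ℤ) : ℂ) = 1 := by
        rcases Int.units_eq_one_or (a g) with h | h <;> simp [h]
      simp [lin, ← hab, this]
      ring
    rw [this]
    exact two_nsmul_lin_mem_P a
  push Not at ha hb hab
  obtain ⟨x, hx⟩ := ha
  obtain ⟨y, hy⟩ := hb
  obtain ⟨z, hz⟩ := hab
  have key := dihedral_mem_P isTargetGroup_units_prod (a.prod b) (by
    intro w
    obtain ⟨i, j, k, hw⟩ := units_surjective_aux (a.prod b x) (a.prod b y) (a.prod b z)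
      ((Int.units_eq_one_or _).resolve_left hx) ((Int.units_eq_one_or _).resolve_left hy) hz w
    exact ⟨x ^ (i : ℕ) * y ^ (j : ℕ) * z ^ (k : ℕ), by rw [hw]; simp⟩) diagRep
  convert key using 1
  rw [hfun]
  funext g
  simp [diagRep, Matrix.trace_fin_two, Matrix.det_fin_two]

theorem lin_pow_mem_P (a : G →* ℤˣ) (n : ℕ) : n • lin a - lin (a ^ n) ∈ P G := by
  induction n with
  | zero =>
    have : (0 : ℕ) • lin a - lin (a ^ 0) = 0 := by
      funext g
      simp [lin]
    rw [this]
    exact (P G).zero_mem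
  | succ n ih =>
    have := (P G).add_mem ih (lin_mul_mem_P (a ^ n) a)
    rw [← pow_succ] at this
    convert this using 1
    rw [add_smul, one_smul]
    abel

end Linear

section Perm

variable {G : Type} [Group G]
variable {X Y : Type} [Fintype X] [Fintype Y]

/-- The character of a permutation representation. -/
def permChar (ρ : G →* Equiv.Perm X) (g : G) : ℂ := ∑ x, if ρ g x = x then 1 else 0

/-- The sign character of a permutation representation. -/
def sgn (ρ : G →* Equiv.Perm X) : G →* ℤˣ := Equiv.Perm.sign.comp ρ

theorem sgn_apply [DecidableEq X] (ρ : G →* Equiv.Perm X) (g : G) :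
    sgn ρ g = Equiv.Perm.sign (ρ g) := by
  rw [sgn, MonoidHom.comp_apply]
  congr!

theorem permChar_apply [DecidableEq X] (ρ : G →* Equiv.Perm X) (g : G) :
    permChar ρ g = ∑ x, if ρ g x = x then 1 else 0 := by
  rw [permChar]
  congr!

/-- The matrices of a permutation representation. -/
def permMat (ρ : G →* Equiv.Perm X) : G →* Matrix X X ℂ where
  toFun g := (ρ g⁻¹).permMatrix ℂ
  map_one' := by simp
  map_mul' g h := by
    rw [mul_inv_rev, map_mul, Matrix.permMatrix_mul]

theorem trace_permMat (ρ : G →* Equiv.Perm X) (g : G) : (permMat ρ g).trace = permChar ρ g := by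
  simp only [permMat, MonoidHom.coe_mk, OneHom.coe_mk, Matrix.trace, Matrix.diag, permChar,
    Equiv.Perm.permMatrix, PEquiv.toMatrix_apply, Equiv.toPEquiv_apply, Option.mem_def,
    Option.some.injEq]
  refine Finset.sum_congr rfl fun x _ => ?_
  congr 1
  rw [map_inv, Equiv.Perm.inv_eq_iff_eq]
  exact propext eq_comm

theorem det_permMat (ρ : G →* Equiv.Perm X) (g : G) :
    (permMat ρ g).det = ((sgn ρ g : ℤ) : ℂ) := by
  simp [permMat, sgn_apply, Matrix.det_permutation]

theorem isGenChar_permChar (ρ : G →* Equiv.Perm X) : IsGenChar (permChar ρ) := by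
  have h : permChar ρ = fun g => (permMat ρ g).trace := funext fun g => (trace_permMat ρ g).symm
  rw [h]
  exact (isChar_trace _).isGenChar

theorem permChar_one (ρ : G →* Equiv.Perm X) : permChar ρ 1 = Fintype.card X := by
  simp [permChar]

/-- The difference between a permutation character and `n - 1 + det`. -/
def defect (ρ : G →* Equiv.Perm X) (g : G) : ℂ := permChar ρ g - Fintype.card X - lin (sgn ρ) g

theorem defect_eq (ρ : G →* Equiv.Perm X) :
    defect ρ = permChar ρ - (fun _ => (Fintype.card X : ℂ)) - lin (sgn ρ) := rfl

theorem permChar_congr {ρ : G →* Equiv.Perm X} {σ : G →* Equiv.Perm Y} (e : X ≃ Y)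
    (h : ∀ g x, e (ρ g x) = σ g (e x)) : permChar ρ = permChar σ := by
  funext g
  refine Fintype.sum_equiv e _ _ fun x => ?_
  simp only [← h, e.apply_eq_iff_eq]

theorem sgn_congr {ρ : G →* Equiv.Perm X} {σ : G →* Equiv.Perm Y} (e : X ≃ Y)
    (h : ∀ g x, e (ρ g x) = σ g (e x)) : sgn ρ = sgn σ := by
  ext g
  rw [sgn_apply, sgn_apply, Equiv.Perm.sign_eq_sign_of_equiv _ _ e (h g)]

theorem defect_congr {ρ : G →* Equiv.Perm X} {σ : G →* Equiv.Perm Y} (e : X ≃ Y)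
    (h : ∀ g x, e (ρ g x) = σ g (e x)) : defect ρ = defect σ := by
  rw [defect_eq, defect_eq, permChar_congr e h, sgn_congr e h, Fintype.card_congr e]

theorem isGenChar_defect [Fintype G] (ρ : G →* Equiv.Perm X) : IsGenChar (defect ρ) :=
  ((isGenChar_permChar ρ).sub (by simpa using isGenChar_intCast (G := G) (Fintype.card X))).sub
    (isGenChar_lin _)

theorem conj_permChar (ρ : G →* Equiv.Perm X) (g : G) :
    starRingEnd ℂ (permChar ρ g) = permChar ρ g := by
  simp only [permChar, map_sum, apply_ite, map_one, map_zero]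

theorem two_mul_defect_mem_P [Fintype G] (ρ : G →* Equiv.Perm X) :
    (fun g => 2 * defect ρ g) ∈ P G := by
  refine two_mul_mem_P (isGenChar_defect ρ) ?_ ?_
  · simp [defect, permChar_one, lin]
  · intro g
    simp [defect, conj_permChar, lin]

theorem defect_mem_P_of_subsingleton [Fintype G] [Subsingleton X] (ρ : G →* Equiv.Perm X) :
    defect ρ ∈ P G := by
  have : defect ρ = 0 := by
    funext g
    have h : ρ g = 1 := Subsingleton.elim _ _
    simp [defect, permChar, lin, sgn_apply, h]
  rw [this]
  exact (P G).zero_mem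

theorem permChar_sum {Z : Type} [Fintype Z]
    {ρ : G →* Equiv.Perm X} {σ : G →* Equiv.Perm Y} {τ : G →* Equiv.Perm Z} (e : X ⊕ Y ≃ Z)
    (hl : ∀ g x, e (Sum.inl (ρ g x)) = τ g (e (Sum.inl x)))
    (hr : ∀ g x, e (Sum.inr (σ g x)) = τ g (e (Sum.inr x))) :
    permChar τ = permChar ρ + permChar σ := by
  funext g
  simp only [permChar, Pi.add_apply]
  rw [← Equiv.sum_comp e, Fintype.sum_sum_type]
  congr 1
  · refine Finset.sum_congr rfl fun x _ => ?_
    simp only [← hl, e.apply_eq_iff_eq, Sum.inl.injEq]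
  · refine Finset.sum_congr rfl fun x _ => ?_
    simp only [← hr, e.apply_eq_iff_eq, Sum.inr.injEq]

theorem defect_sum_mem_P [Fintype G] {Z : Type} [Fintype Z]
    {ρ : G →* Equiv.Perm X} {σ : G →* Equiv.Perm Y} {τ : G →* Equiv.Perm Z} (e : X ⊕ Y ≃ Z)
    (hl : ∀ g x, e (Sum.inl (ρ g x)) = τ g (e (Sum.inl x)))
    (hr : ∀ g x, e (Sum.inr (σ g x)) = τ g (e (Sum.inr x)))
    (hρ : defect ρ ∈ P G) (hσ : defect σ ∈ P G) : defect τ ∈ P G := by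
  have h1 := permChar_sum e hl hr
  have h2 : sgn τ = sgn ρ * sgn σ := by
    ext g
    rw [MonoidHom.mul_apply, sgn_apply, sgn_apply, sgn_apply, ← Equiv.Perm.sign_sumCongr]
    rw [Equiv.Perm.sign_eq_sign_of_equiv _ (τ g) e]
    rintro (x | x)
    · exact hl g x
    · exact hr g x
  have h3 : (Fintype.card Z : ℂ) = Fintype.card X + Fintype.card Y := by
    rw [← Fintype.card_congr e, Fintype.card_sum]
    push_cast
    rfl
  have : defect τ = defect ρ + defect σ + (lin (sgn ρ) + lin (sgn σ) - lin (sgn ρ * sgn σ)) := by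
    funext g
    simp only [defect, h1, h2, h3, Pi.add_apply, Pi.sub_apply]
    ring
  rw [this]
  exact (P G).add_mem ((P G).add_mem hρ hσ) (lin_mul_mem_P _ _)

end Perm

section Fibration

variable {G : Type} [Group G] {X B Y : Type}

/-- An equivariant map `q` from a `G`-set `X` onto a transitive `G`-set `B`, with a
parametrisation `i` of the fibre over `b₀` as a set with an action of the stabiliser `M`. -/
structure IsFib (ρX : G →* Equiv.Perm X) (ρB : G →* Equiv.Perm B) (q : X → B) (b₀ : B)
    (M : Subgroup G) (ρY : M →* Equiv.Perm Y) (i : Y → X) : Prop where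
  equivariant : ∀ g x, q (ρX g x) = ρB g (q x)
  mem_iff : ∀ g, g ∈ M ↔ ρB g b₀ = b₀
  transitive : ∀ b, ∃ g, ρB g b₀ = b
  injective : Function.Injective i
  fibre : ∀ x, q x = b₀ ↔ ∃ y, i y = x
  action : ∀ m y, i (ρY m y) = ρX m (i y)

/-- An element carrying the base point to `b`. -/
def translate {ρB : G →* Equiv.Perm B} {b₀ : B} (h : ∀ b, ∃ g, ρB g b₀ = b) (b : B) : G :=
  (h b).choose

theorem translate_spec {ρB : G →* Equiv.Perm B} {b₀ : B} (h : ∀ b, ∃ g, ρB g b₀ = b) (b : B) :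
    ρB (translate h b) b₀ = b := (h b).choose_spec

/-- The cocycle of the choice of translating elements. -/
def twist {ρB : G →* Equiv.Perm B} {b₀ : B} {M : Subgroup G} (h : ∀ b, ∃ g, ρB g b₀ = b)
    (hM : ∀ g, g ∈ M ↔ ρB g b₀ = b₀) (g : G) (b : B) : M :=
  ⟨(translate h (ρB g b))⁻¹ * g * translate h b, by
    rw [hM, map_mul, map_mul, Equiv.Perm.mul_apply, Equiv.Perm.mul_apply, translate_spec,
      map_inv, Equiv.Perm.inv_eq_iff_eq, translate_spec]⟩

theorem translate_mul_twist {ρB : G →* Equiv.Perm B} {b₀ : B} {M : Subgroup G}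
    (h : ∀ b, ∃ g, ρB g b₀ = b) (hM : ∀ g, g ∈ M ↔ ρB g b₀ = b₀) (g : G) (b : B) :
    translate h (ρB g b) * (twist h hM g b : G) = g * translate h b := by
  simp [twist, mul_assoc]

theorem twist_mul {ρB : G →* Equiv.Perm B} {b₀ : B} {M : Subgroup G}
    (h : ∀ b, ∃ g, ρB g b₀ = b) (hM : ∀ g, g ∈ M ↔ ρB g b₀ = b₀) (g g' : G) (b : B) :
    twist h hM (g * g') b = twist h hM g (ρB g' b) * twist h hM g' b := by
  apply Subtype.ext
  simp [twist, mul_assoc]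

theorem twist_one {ρB : G →* Equiv.Perm B} {b₀ : B} {M : Subgroup G}
    (h : ∀ b, ∃ g, ρB g b₀ = b) (hM : ∀ g, g ∈ M ↔ ρB g b₀ = b₀) (b : B) :
    twist h hM 1 b = 1 := by
  apply Subtype.ext
  simp [twist]

/-- The action of `G` on `B × ℤˣ` induced by a quadratic character of the stabiliser. -/
def signedPerm {ρB : G →* Equiv.Perm B} {b₀ : B} {M : Subgroup G}
    (h : ∀ b, ∃ g, ρB g b₀ = b) (hM : ∀ g, g ∈ M ↔ ρB g b₀ = b₀) (ε : M →* ℤˣ) :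
    G →* Equiv.Perm (B × ℤˣ) :=
  MonoidHom.toHomPerm
    { toFun := fun g => (fun z => (ρB g z.1, ε (twist h hM g z.1) * z.2) : B × ℤˣ → B × ℤˣ)
      map_one' := by
        funext z
        simp [twist_one]
        rfl
      map_mul' := fun g g' => by
        funext z
        simp [twist_mul, mul_assoc]
        rfl }

theorem signedPerm_apply {ρB : G →* Equiv.Perm B} {b₀ : B} {M : Subgroup G}
    (h : ∀ b, ∃ g, ρB g b₀ = b) (hM : ∀ g, g ∈ M ↔ ρB g b₀ = b₀) (ε : M →* ℤˣ) (g : G)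
    (z : B × ℤˣ) : signedPerm h hM ε g z = (ρB g z.1, ε (twist h hM g z.1) * z.2) := rfl

theorem isFib_self {ρB : G →* Equiv.Perm B} {b₀ : B} {M : Subgroup G}
    (h : ∀ b, ∃ g, ρB g b₀ = b) (hM : ∀ g, g ∈ M ↔ ρB g b₀ = b₀) :
    IsFib ρB ρB id b₀ M (1 : M →* Equiv.Perm Unit) (fun _ => b₀) where
  equivariant _ _ := rfl
  mem_iff := hM
  transitive := h
  injective _ _ _ := rfl
  fibre x := by simp [eq_comm]
  action m _ := ((hM m).1 m.2).symm

/-- The action on `ℤˣ` through a quadratic character. -/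
def unitsPerm (ε : G →* ℤˣ) : G →* Equiv.Perm ℤˣ := (MulAction.toPermHom ℤˣ ℤˣ).comp ε

theorem unitsPerm_apply (ε : G →* ℤˣ) (g : G) (z : ℤˣ) : unitsPerm ε g z = ε g * z := rfl

theorem permChar_unitsPerm (ε : G →* ℤˣ) (g : G) :
    permChar (unitsPerm ε) g = 1 + ((ε g : ℤ) : ℂ) := by
  rcases Int.units_eq_one_or (ε g) with h | h
  · simp [permChar, unitsPerm_apply, h]
    norm_num
  · simp [permChar, unitsPerm_apply, h]

theorem sgn_unitsPerm (ε : G →* ℤˣ) : sgn (unitsPerm ε) = ε := by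
  ext1 g
  rw [sgn_apply]
  rcases Int.units_eq_one_or (ε g) with h | h
  · have : unitsPerm ε g = 1 := by
      ext1 z
      rw [unitsPerm_apply, h, one_mul, Equiv.Perm.one_apply]
    rw [this, h, map_one]
  · have : unitsPerm ε g = Equiv.swap 1 (-1) := by
      ext1 z
      rw [unitsPerm_apply, h]
      rcases Int.units_eq_one_or z with rfl | rfl <;> simp
    rw [this, h, Equiv.Perm.sign_swap (by decide)]

theorem defect_unitsPerm (ε : G →* ℤˣ) : defect (unitsPerm ε) = 0 := by
  funext g
  rw [defect, permChar_unitsPerm, sgn_unitsPerm, lin, Fintype.card_units_int]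
  simp
  ring

theorem isFib_signedPerm {ρB : G →* Equiv.Perm B} {b₀ : B} {M : Subgroup G}
    (h : ∀ b, ∃ g, ρB g b₀ = b) (hM : ∀ g, g ∈ M ↔ ρB g b₀ = b₀) (ε : M →* ℤˣ) :
    IsFib (signedPerm h hM ε) ρB Prod.fst b₀ M (unitsPerm ε) (fun z => (b₀, z)) where
  equivariant _ _ := rfl
  mem_iff := hM
  transitive := h
  injective x y hxy := by simpa using hxy
  fibre x := ⟨fun hx => ⟨x.2, by rw [← hx]⟩, by rintro ⟨y, rfl⟩; rfl⟩
  action m z := by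
    have h1 := (hM m).1 m.2
    rw [signedPerm_apply, unitsPerm_apply]
    simp only [h1]
    have h2 : twist h hM m b₀ = (⟨translate h b₀, by rw [hM, translate_spec]⟩ : M)⁻¹ * m *
        (⟨translate h b₀, by rw [hM, translate_spec]⟩ : M) := by
      apply Subtype.ext
      simp [twist, h1]
    rw [h2, map_mul, map_mul, map_inv, mul_comm (ε _)⁻¹, inv_mul_cancel_right]

theorem sign_prod_twisted {B Y : Type} [Fintype B] [Fintype Y] (f : Equiv.Perm B)
    (k : B → Equiv.Perm Y) (p : Equiv.Perm (B × Y)) (hp : ∀ z, p z = (f z.1, k z.1 z.2)) :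
    Equiv.Perm.sign p = Equiv.Perm.sign f ^ Fintype.card Y * ∏ b, Equiv.Perm.sign (k b) := by
  have : p = Equiv.prodCongrLeft (fun _ => f) * Equiv.prodCongrRight k := by
    ext1 z
    rw [hp, Equiv.Perm.mul_apply]
    rfl
  rw [this, map_mul, Equiv.Perm.sign_prodCongrLeft, Equiv.Perm.sign_prodCongrRight]
  simp

namespace IsFib

variable {ρX : G →* Equiv.Perm X} {ρB : G →* Equiv.Perm B} {q : X → B} {b₀ : B}
  {M : Subgroup G} {ρY : M →* Equiv.Perm Y} {i : Y → X}

/-- The trivialisation of a fibration given by translating elements. -/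
def equiv (h : IsFib ρX ρB q b₀ M ρY i) : B × Y ≃ X :=
  Equiv.ofBijective (fun z => ρX (translate h.transitive z.1) (i z.2)) <| by
    have hq : ∀ z : B × Y, q (ρX (translate h.transitive z.1) (i z.2)) = z.1 := fun z => by
      rw [h.equivariant, (h.fibre _).2 ⟨_, rfl⟩, translate_spec]
    constructor
    · intro z w hzw
      have h1 : z.1 = w.1 := by
        rw [← hq z, ← hq w]
        exact congrArg q hzw
      refine Prod.ext h1 (h.injective ?_)
      simp only [h1] at hzw
      exact (ρX _).injective hzw
    · intro x
      obtain ⟨y, hy⟩ := (h.fibre (ρX (translate h.transitive (q x))⁻¹ x)).1 (by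
        rw [h.equivariant, map_inv, Equiv.Perm.inv_eq_iff_eq, translate_spec])
      refine ⟨(q x, y), ?_⟩
      simp [hy]

theorem equiv_apply (h : IsFib ρX ρB q b₀ M ρY i) (z : B × Y) :
    h.equiv z = ρX (translate h.transitive z.1) (i z.2) := rfl

theorem apply_equiv (h : IsFib ρX ρB q b₀ M ρY i) (g : G) (z : B × Y) :
    ρX g (h.equiv z) = h.equiv (ρB g z.1, ρY (twist h.transitive h.mem_iff g z.1) z.2) := by
  rw [equiv_apply, equiv_apply, h.action, ← Equiv.Perm.mul_apply, ← map_mul, ← Equiv.Perm.mul_apply, ← map_mul,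
    translate_mul_twist]

variable [Fintype X] [Fintype Y]

theorem extendZero_permChar (h : IsFib ρX ρB q b₀ M ρY i) (g : G) :
    extendZero M (permChar ρY) g = ∑ x, if q x = b₀ ∧ ρX g x = x then 1 else 0 := by
  by_cases hg : g ∈ M
  · rw [extendZero_of_mem _ hg]
    refine Fintype.sum_of_injective i h.injective _ _ (fun x hx => ?_) fun y => ?_
    · rw [if_neg]
      rintro ⟨h1, -⟩
      exact hx ((h.fibre x).1 h1)
    · have h1 : q (i y) = b₀ := (h.fibre _).2 ⟨y, rfl⟩
      have h2 : ρY ⟨g, hg⟩ y = y ↔ ρX g (i y) = i y := by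
        rw [← h.injective.eq_iff, h.action]
      simp only [h1, h2, true_and]
  · rw [extendZero_of_notMem _ hg, Finset.sum_eq_zero]
    intro x _
    rw [if_neg]
    rintro ⟨h1, h2⟩
    refine hg ((h.mem_iff g).2 ?_)
    rw [← h1, ← h.equivariant, h2]

theorem indChar_permChar [Fintype G] (h : IsFib ρX ρB q b₀ M ρY i) :
    indChar M (permChar ρY) = permChar ρX := by
  funext g
  have hcard : ∀ b, (∑ x : G, if ρB x b₀ = b then (1 : ℂ) else 0) = Nat.card M := by
    intro b
    obtain ⟨t, rfl⟩ := h.transitive b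
    rw [← Equiv.sum_comp (Equiv.mulLeft t)]
    simp only [Equiv.coe_mulLeft, map_mul, Equiv.Perm.mul_apply, EmbeddingLike.apply_eq_iff_eq,
      ← h.mem_iff]
    rw [Finset.sum_boole, Nat.card_eq_fintype_card, Fintype.card_subtype]
  have hx : ∀ u : G, extendZero M (permChar ρY) (u⁻¹ * g * u) =
      ∑ x, if ρB u b₀ = q x then (if ρX g x = x then 1 else 0) else 0 := by
    intro u
    rw [h.extendZero_permChar]
    refine Fintype.sum_equiv (ρX u) _ _ fun x => ?_
    rw [← ite_and]
    refine if_congr (and_congr ?_ ?_) rfl rfl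
    · rw [h.equivariant, EmbeddingLike.apply_eq_iff_eq, eq_comm]
    · rw [map_mul, map_mul, Equiv.Perm.mul_apply, Equiv.Perm.mul_apply, map_inv,
        Equiv.Perm.inv_eq_iff_eq, eq_comm]
  rw [indChar_apply]
  simp only [hx]
  rw [Finset.sum_comm]
  have : ∀ x, (∑ u : G, if ρB u b₀ = q x then (if ρX g x = x then (1 : ℂ) else 0) else 0) =
      (Nat.card M : ℂ) * if ρX g x = x then 1 else 0 := by
    intro x
    rw [← hcard (q x), Finset.sum_mul]
    refine Finset.sum_congr rfl fun u _ => ?_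
    split_ifs <;> simp
  simp only [this]
  rw [← Finset.mul_sum, inv_mul_cancel_left₀ (by simp), permChar]

variable [Fintype B]

theorem sgn_eq (h : IsFib ρX ρB q b₀ M ρY i) (g : G) :
    sgn ρX g = sgn ρB g ^ Fintype.card Y *
      ∏ b, sgn ρY (twist h.transitive h.mem_iff g b) := by
  have h1 : sgn ρX g = Equiv.Perm.sign (h.equiv.symm.permCongr (ρX g)) := by
    rw [sgn_apply, Equiv.Perm.sign_permCongr]
  rw [h1, sign_prod_twisted (ρB g) (fun b => ρY (twist h.transitive h.mem_iff g b))]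
  · simp only [sgn_apply]
  · intro z
    rw [Equiv.permCongr_apply, Equiv.symm_symm, h.apply_equiv, Equiv.symm_apply_apply]

theorem card_eq (h : IsFib ρX ρB q b₀ M ρY i) :
    Fintype.card X = Fintype.card B * Fintype.card Y := by
  rw [← Fintype.card_congr h.equiv, Fintype.card_prod]

theorem defect_mem_P [Fintype G] (h : IsFib ρX ρB q b₀ M ρY i) (hY : defect ρY ∈ P M)
    (hB : defect ρB ∈ P G)
    (hZ : ∀ σ : G →* Equiv.Perm (B × ℤˣ), (∀ g z, (σ g z).1 = ρB g z.1) → defect σ ∈ P G) :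
    defect ρX ∈ P G := by
  set σ := signedPerm h.transitive h.mem_iff (sgn ρY) with hσ
  have hfibσ := isFib_signedPerm h.transitive h.mem_iff (sgn ρY)
  have hfibB := isFib_self h.transitive h.mem_iff
  have hdY : defect ρY = permChar ρY - Fintype.card Y • permChar (1 : M →* Equiv.Perm Unit) +
      2 • permChar (1 : M →* Equiv.Perm Unit) - permChar (unitsPerm (sgn ρY)) := by
    funext m
    simp only [defect, Pi.add_apply, Pi.sub_apply, Pi.smul_apply, permChar_unitsPerm, lin]
    simp [permChar]
    ring
  have hD := indChar_mem_P M hY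
  rw [← indHom_apply, hdY, map_sub, map_add, map_sub, map_nsmul, map_nsmul] at hD
  simp only [indHom_apply, hfibσ.indChar_permChar, hfibB.indChar_permChar,
    h.indChar_permChar] at hD
  have hs : sgn ρX = sgn ρB ^ Fintype.card Y * sgn σ := by
    ext g
    rw [MonoidHom.mul_apply, MonoidHom.pow_apply, h.sgn_eq, hfibσ.sgn_eq]
    congr 2
    rw [Fintype.card_units_int, Int.units_sq, one_mul]
    simp only [sgn_unitsPerm]
  have hc : (Fintype.card X : ℂ) = Fintype.card B * Fintype.card Y := by
    rw [h.card_eq, Nat.cast_mul]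
  have : defect ρX = (permChar ρX - Fintype.card Y • permChar ρB + 2 • permChar ρB - permChar σ) +
      Fintype.card Y • defect ρB - 2 • defect ρB + defect σ - 2 • lin (sgn ρB) +
      (Fintype.card Y • lin (sgn ρB) - lin (sgn ρB ^ Fintype.card Y)) +
      (lin (sgn ρB ^ Fintype.card Y) + lin (sgn σ) - lin (sgn ρB ^ Fintype.card Y * sgn σ)) := by
    funext g
    simp only [Pi.add_apply, Pi.sub_apply, Pi.smul_apply]
    simp only [defect, hs, hc, nsmul_eq_mul, Fintype.card_prod, Fintype.card_units_int]
    push_cast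
    ring
  rw [this]
  refine (P G).add_mem ((P G).add_mem ((P G).sub_mem ((P G).add_mem ((P G).sub_mem
    ((P G).add_mem hD ((P G).nsmul_mem hB _)) ((P G).nsmul_mem hB _)) (hZ σ fun _ _ => rfl))
    (two_nsmul_lin_mem_P _)) (lin_pow_mem_P _ _)) (lin_mul_mem_P _ _)

end IsFib

end Fibration

section Dihedral

variable {n : ℕ}

/-- The two-dimensional representation of a dihedral group attached to a character of its
rotation subgroup. -/
def dihedralRep (ψ : AddChar (ZMod n) ℂ) : DihedralGroup n →* Matrix (Fin 2) (Fin 2) ℂ where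
  toFun
    | .r i => !![ψ i, 0; 0, ψ (-i)]
    | .sr i => !![0, ψ (-i); ψ i, 0]
  map_one' := by
    rw [DihedralGroup.one_def]
    ext i j
    fin_cases i <;> fin_cases j <;> simp
  map_mul' x y := by
    rcases x with i | i <;> rcases y with j | j <;>
      simp [← AddChar.map_add_eq_mul, sub_eq_add_neg, add_comm]

theorem dihedralRep_r (ψ : AddChar (ZMod n) ℂ) (i : ZMod n) :
    dihedralRep ψ (.r i) = !![ψ i, 0; 0, ψ (-i)] := rfl

theorem dihedralRep_sr (ψ : AddChar (ZMod n) ℂ) (i : ZMod n) :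
    dihedralRep ψ (.sr i) = !![0, ψ (-i); ψ i, 0] := rfl

/-- The function `χ - 1 - det` for the representation `dihedralRep ψ`. -/
def dihedralFun (ψ : AddChar (ZMod n) ℂ) (d : DihedralGroup n) : ℂ :=
  (dihedralRep ψ d).trace - 1 - (dihedralRep ψ d).det

theorem dihedralFun_r (ψ : AddChar (ZMod n) ℂ) (i : ZMod n) :
    dihedralFun ψ (.r i) = ψ i + ψ (-i) - 2 := by
  simp [dihedralFun, dihedralRep_r, Matrix.trace_fin_two, Matrix.det_fin_two,
    ← AddChar.map_add_eq_mul]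
  ring

theorem dihedralFun_sr (ψ : AddChar (ZMod n) ℂ) (i : ZMod n) :
    dihedralFun ψ (.sr i) = 0 := by
  simp [dihedralFun, dihedralRep_sr, Matrix.trace_fin_two, Matrix.det_fin_two,
    ← AddChar.map_add_eq_mul]

/-- The action of the dihedral group on the vertices of a polygon. -/
def dihedralPerm : DihedralGroup n →* Equiv.Perm (ZMod n) where
  toFun
    | .r i => Equiv.addRight i
    | .sr i => (Equiv.addRight i).trans (Equiv.neg _)
  map_one' := by
    rw [DihedralGroup.one_def]
    ext x
    simp
  map_mul' x y := by
    rcases x with i | i <;> rcases y with j | j <;> ext x <;>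
      simp [sub_eq_add_neg, add_assoc, add_comm, add_left_comm]

theorem dihedralPerm_r (i x : ZMod n) : dihedralPerm (.r i) x = x + i := rfl

theorem dihedralPerm_sr (i x : ZMod n) : dihedralPerm (.sr i) x = -(x + i) := rfl

theorem dihedralPerm_injective (h2 : (2 : ZMod n) ≠ 0) :
    Function.Injective (dihedralPerm (n := n)) := by
  intro d e hde
  have h (x : ZMod n) : dihedralPerm d x = dihedralPerm e x := by rw [hde]
  have h0 := h 0
  have h1 := h 1
  rcases d with i | i <;> rcases e with j | j <;>
    simp only [dihedralPerm_r, dihedralPerm_sr, zero_add] at h0 h1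
  · rw [h0]
  · exact absurd (by linear_combination h1 - h0) h2
  · exact absurd (by linear_combination h0 - h1) h2
  · rw [neg_injective h0]

theorem exists_dihedral_lift {K : Type} [Group K] (h2 : (2 : ZMod n) ≠ 0)
    (ρ : K →* Equiv.Perm (ZMod n))
    (hρ : ∀ g, ∃ b, (∀ x, ρ g x = x + b) ∨ ∀ x, ρ g x = -x + b) :
    ∃ φ : K →* DihedralGroup n, ∀ g, dihedralPerm (φ g) = ρ g := by
  have hr : ∀ g, ρ g ∈ (dihedralPerm (n := n)).range := by
    intro g
    obtain ⟨b, hb | hb⟩ := hρ g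
    · exact ⟨.r b, Equiv.ext fun x => by rw [hb, dihedralPerm_r]⟩
    · exact ⟨.sr (-b), Equiv.ext fun x => by rw [hb, dihedralPerm_sr]; ring⟩
  let e := MonoidHom.ofInjective (dihedralPerm_injective h2)
  refine ⟨(e.symm : _ →* DihedralGroup n).comp (ρ.codRestrict _ hr), fun g => ?_⟩
  have : e (e.symm ⟨ρ g, hr g⟩) = ⟨ρ g, hr g⟩ := e.apply_symm_apply _
  exact congrArg Subtype.val this

end Dihedral

section FourPoints

/-- The determinant of the standard representation of the dihedral group of order `8`. -/
def det4 : DihedralGroup 4 →* ℤˣ where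
  toFun
    | .r _ => 1
    | .sr _ => -1
  map_one' := rfl
  map_mul' := by decide

/-- The quadratic character of the dihedral group of order `8` with kernel the Klein four group
generated by the reflections `sr 0` and `sr 2`. -/
def parity4 : DihedralGroup 4 →* ℤˣ where
  toFun
    | .r i => (-1) ^ i.val
    | .sr i => (-1) ^ i.val
  map_one' := rfl
  map_mul' := by decide

/-- The faithful character of `ZMod 4`. -/
def char4 : AddChar (ZMod 4) ℂ := AddChar.zmodChar 4 Complex.I_pow_four

/-- The integer values of `dihedralFun char4`. -/
def value4 : DihedralGroup 4 → ℤ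
  | .r i => if i = 0 then 0 else if i = 2 then -4 else -2
  | .sr _ => 0

theorem dihedralFun_char4 (d : DihedralGroup 4) : dihedralFun char4 d = value4 d := by
  rcases d with i | i
  · have h : ∀ j : ZMod 4, char4 j = Complex.I ^ j.val := AddChar.zmodChar_apply _
    rw [dihedralFun_r, h, h]
    have hi : i = 0 ∨ i = 1 ∨ i = 2 ∨ i = 3 := by
      revert i
      decide
    have v1 : (1 : ZMod 4).val = 1 := rfl
    have v2 : (2 : ZMod 4).val = 2 := rfl
    have v3 : (3 : ZMod 4).val = 3 := rfl
    rcases hi with rfl | rfl | rfl | rfl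
    · norm_num [value4]
    · rw [show (-1 : ZMod 4) = 3 by decide, v1, v3, Complex.I_pow_three]
      norm_num [value4, show ¬ (1 : ZMod 4) = 0 by decide, show ¬ (1 : ZMod 4) = 2 by decide]
    · rw [show (-2 : ZMod 4) = 2 by decide, v2, Complex.I_sq]
      norm_num [value4, show ¬ (2 : ZMod 4) = 0 by decide]
    · rw [show (-3 : ZMod 4) = 1 by decide, v1, v3, Complex.I_pow_three]
      norm_num [value4, show ¬ (3 : ZMod 4) = 0 by decide, show ¬ (3 : ZMod 4) = 2 by decide]
  · rw [dihedralFun_sr]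
    simp [value4]

theorem fixedPoints4 : ∀ d : DihedralGroup 4,
    (∑ x, if dihedralPerm d x = x then (1 : ℤ) else 0) - 4 - ((Equiv.Perm.sign (dihedralPerm d) : ℤ) - 1) =
      value4 d + ((parity4 d : ℤ) - 1) + ((det4 d : ℤ) - 1) -
        ((parity4 d : ℤ) * (det4 d : ℤ) - 1) := by
  decide

theorem generate4 : ∀ i j : ZMod 4, (-1 : ℤˣ) ^ j.val = -1 → ∀ d : DihedralGroup 4,
    ∃ m n : Fin 4, d = DihedralGroup.r j ^ (m : ℕ) * DihedralGroup.sr i ^ (n : ℕ) := by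
  decide

variable {G : Type} [Group G]

theorem surjective_of_characters (φ : G →* DihedralGroup 4) (h1 : ∃ g, det4 (φ g) ≠ 1)
    (h2 : ∃ g, parity4 (φ g) ≠ 1) (h3 : ∃ g, parity4 (φ g) * det4 (φ g) ≠ 1) :
    Function.Surjective φ := by
  obtain ⟨s, i, hs⟩ : ∃ s i, φ s = .sr i := by
    obtain ⟨g, hg⟩ := h1
    cases hc : φ g with
    | r i => exact absurd (by rw [hc]; rfl) hg
    | sr i => exact ⟨g, i, hc⟩
  obtain ⟨t, j, ht, hj⟩ : ∃ t j, φ t = .r j ∧ (-1 : ℤˣ) ^ j.val = -1 := by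
    obtain ⟨u, hu⟩ := h2
    obtain ⟨v, hv⟩ := h3
    cases hc : φ u with
    | r i => exact ⟨u, i, hc, (Int.units_eq_one_or _).resolve_left (by rwa [hc] at hu)⟩
    | sr i =>
      cases hd : φ v with
      | r k =>
        refine ⟨v, k, hd, (Int.units_eq_one_or _).resolve_left ?_⟩
        rw [hd] at hv
        exact fun h => hv (by rw [show det4 (.r k) = 1 from rfl, mul_one]; exact h)
      | sr k =>
        refine ⟨u * v, k - i, by rw [map_mul, hc, hd, DihedralGroup.sr_mul_sr], ?_⟩
        rw [hc] at hu
        rw [hd] at hv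
        exact (by decide : ∀ i k : ZMod 4, parity4 (.sr i) ≠ 1 →
          parity4 (.sr k) * det4 (.sr k) ≠ 1 → (-1 : ℤˣ) ^ (k - i).val = -1) i k hu hv
  intro d
  obtain ⟨m, n, hd⟩ := generate4 i j hj d
  exact ⟨t ^ (m : ℕ) * s ^ (n : ℕ), by rw [map_mul, map_pow, map_pow, ht, hs, hd]⟩

variable [Fintype G]

/-- A sign function on the dihedral group of order `8`, multiplicative on a Klein four group. -/
def kleinSign (i : ZMod 4) (d : DihedralGroup 4) : ℤˣ := if d = .r 0 ∨ d = .sr i then 1 else -1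

theorem kleinSign_mul_parity : ∀ d e : DihedralGroup 4, parity4 d = 1 → parity4 e = 1 →
    kleinSign 0 (d * e) = kleinSign 0 d * kleinSign 0 e := by
  decide

theorem kleinSign_mul_parity_det : ∀ d e : DihedralGroup 4, parity4 d * det4 d = 1 →
    parity4 e * det4 e = 1 → kleinSign 1 (d * e) = kleinSign 1 d * kleinSign 1 e := by
  decide

theorem value4_parity : ∀ d : DihedralGroup 4, parity4 d = 1 →
    value4 d = ((kleinSign 0 d : ℤ) - 1) + ((kleinSign 0 d : ℤ) * (det4 d : ℤ) - 1) -
      ((det4 d : ℤ) - 1) := by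
  decide

theorem value4_parity_det : ∀ d : DihedralGroup 4, parity4 d * det4 d = 1 →
    value4 d = ((kleinSign 1 d : ℤ) - 1) + ((kleinSign 1 d : ℤ) * (det4 d : ℤ) - 1) -
      ((det4 d : ℤ) - 1) := by
  decide

theorem comp_mem_P_of_kleinSign (φ : G →* DihedralGroup 4) (i : ZMod 4)
    (hmul : ∀ g h, kleinSign i (φ g * φ h) = kleinSign i (φ g) * kleinSign i (φ h))
    (hval : ∀ g, value4 (φ g) = ((kleinSign i (φ g) : ℤ) - 1) +
      ((kleinSign i (φ g) : ℤ) * (det4 (φ g) : ℤ) - 1) - ((det4 (φ g) : ℤ) - 1)) :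
    (fun g => dihedralFun char4 (φ g)) ∈ P G := by
  let a : G →* ℤˣ :=
    { toFun := fun g => kleinSign i (φ g)
      map_one' := by
        rw [map_one, DihedralGroup.one_def]
        simp [kleinSign]
      map_mul' := fun g h => by rw [map_mul, hmul] }
  have := lin_mul_mem_P a (a * det4.comp φ)
  convert this using 1
  funext g
  rw [dihedralFun_char4, hval]
  have ha : a * (a * det4.comp φ) = det4.comp φ := by
    rw [← mul_assoc]
    ext g
    simp [Int.units_mul_self]
  rw [ha]
  simp [lin, a]

theorem dihedralFun_comp_mem_P (φ : G →* DihedralGroup 4) :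
    (fun g => dihedralFun char4 (φ g)) ∈ P G := by
  by_cases h1 : ∀ g, det4 (φ g) = 1
  · have hr : ∀ g, ∃ i, φ g = .r i := by
      intro g
      have := h1 g
      cases hc : φ g with
      | r i => exact ⟨i, rfl⟩
      | sr i =>
        rw [hc] at this
        exact absurd this (by rw [show det4 (.sr i) = -1 from rfl]; decide)
    let χ : G →* ℂ :=
      { toFun := fun g => dihedralRep char4 (φ g) 0 0
        map_one' := by simp
        map_mul' := fun g h => by
          obtain ⟨i, hi⟩ := hr g
          obtain ⟨j, hj⟩ := hr h
          rw [map_mul, hi, hj, DihedralGroup.r_mul_r]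
          simp [dihedralRep_r, AddChar.map_add_eq_mul] }
    have hχ := memP.conj_add _ ((isGenChar_linear χ).sub isGenChar_one) (by simp)
    convert mem_P.2 hχ using 1
    funext g
    obtain ⟨i, hi⟩ := hr g
    have : χ g = char4 i := by simp [χ, hi, dihedralRep_r]
    simp [hi, dihedralFun_r, conjFun, this, AddChar.map_neg_eq_conj]
    ring
  by_cases h2 : ∀ g, parity4 (φ g) = 1
  · exact comp_mem_P_of_kleinSign φ 0 (fun g h => kleinSign_mul_parity _ _ (h2 g) (h2 h))
      fun g => value4_parity _ (h2 g)
  by_cases h3 : ∀ g, parity4 (φ g) * det4 (φ g) = 1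
  · exact comp_mem_P_of_kleinSign φ 1 (fun g h => kleinSign_mul_parity_det _ _ (h3 g) (h3 h))
      fun g => value4_parity_det _ (h3 g)
  push Not at h1 h2 h3
  exact dihedral_mem_P (Or.inr (Or.inl ⟨MulEquiv.refl _⟩)) φ
    (surjective_of_characters φ h1 h2 h3) (dihedralRep char4)

theorem defect_mem_P_of_four_points (σ : G →* Equiv.Perm (ZMod 4))
    (hσ : ∀ g x, σ g (x + 2) = σ g x + 2) : defect σ ∈ P G := by
  have h4 : ∀ b c : ZMod 4, c ≠ b → c ≠ b + 2 → c = b + 1 ∨ c = b - 1 := by decide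
  obtain ⟨φ, hφ⟩ := exists_dihedral_lift (by decide) σ fun g => by
    have hx : ∀ x : ZMod 4, x = 0 ∨ x = 1 ∨ x = 0 + 2 ∨ x = 1 + 2 := by decide
    refine ⟨σ g 0, ?_⟩
    rcases h4 (σ g 0) (σ g 1) (by simp only [ne_eq, EmbeddingLike.apply_eq_iff_eq]; decide)
      (by simp only [← hσ, ne_eq, EmbeddingLike.apply_eq_iff_eq]; decide) with h | h
    · left
      intro x
      rcases hx x with rfl | rfl | rfl | rfl
      · rw [zero_add]
      · rw [h, add_comm]
      · rw [hσ]; ring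
      · rw [hσ, h]; ring
    · right
      intro x
      have h22 : (2 : ZMod 4) = -2 := by decide
      rcases hx x with rfl | rfl | rfl | rfl
      · rw [neg_zero, zero_add]
      · rw [h]; ring
      · rw [hσ]; linear_combination h22
      · rw [hσ, h]; linear_combination h22
  have h := (P G).add_mem (dihedralFun_comp_mem_P φ)
    (lin_mul_mem_P (parity4.comp φ) (det4.comp φ))
  convert h using 1
  funext g
  have := congrArg (Int.cast : ℤ → ℂ) (fixedPoints4 (φ g))
  rw [hφ, ← sgn_apply] at this
  simp only [Pi.add_apply, Pi.sub_apply, defect, permChar_apply, dihedralFun_char4, lin,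
    ZMod.card, MonoidHom.mul_apply, MonoidHom.comp_apply]
  push_cast at this ⊢
  linear_combination this

theorem defect_mem_P_of_units_prod (σ : G →* Equiv.Perm (ℤˣ × ℤˣ)) (ε : G → ℤˣ)
    (hσ : ∀ g z, (σ g z).1 = ε g * z.1) : defect σ ∈ P G := by
  let e : ℤˣ × ℤˣ ≃ ZMod 4 :=
    { toFun := fun z => if z.1 = 1 then (if z.2 = 1 then 0 else 2) else if z.2 = 1 then 1 else 3
      invFun := fun x => (if x = 0 ∨ x = 2 then 1 else -1, if x = 0 ∨ x = 1 then 1 else -1)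
      left_inv := by unfold Function.LeftInverse; decide
      right_inv := by unfold Function.RightInverse Function.LeftInverse; decide }
  have he : ∀ z : ℤˣ × ℤˣ, e (z.1, -z.2) = e z + 2 := by decide
  have hneg : ∀ g z, σ g (z.1, -z.2) = ((σ g z).1, -(σ g z).2) := by
    intro g z
    refine Prod.ext (by rw [hσ, hσ]) ?_
    have hne : σ g (z.1, -z.2) ≠ σ g z := by
      rw [Ne, EmbeddingLike.apply_eq_iff_eq]
      intro h
      exact (by decide : ∀ u : ℤˣ, -u ≠ u) _ (congrArg Prod.snd h)
    have h2 : (σ g (z.1, -z.2)).2 ≠ (σ g z).2 := fun h =>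
      hne (Prod.ext (by rw [hσ, hσ]) h)
    exact (by decide : ∀ u v : ℤˣ, u ≠ v → u = -v) _ _ h2
  rw [defect_congr (σ := (e.permCongrHom : _ →* _).comp σ) e fun g x => by
    simp [Equiv.permCongrHom]]
  apply defect_mem_P_of_four_points
  intro g x
  have h1 : e.symm (x + 2) = ((e.symm x).1, -(e.symm x).2) := by
    rw [Equiv.symm_apply_eq, he, e.apply_symm_apply]
  simp [Equiv.permCongrHom, h1, hneg, he]

end FourPoints

section Sums

theorem sum_comp_hom {G U : Type} [Group G] [Fintype G] [Group U] [Fintype U] (a : G →* U)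
    [DecidablePred (· ∈ a.range)] (F : U → ℂ) :
    ∑ x, F (a x) = Nat.card a.ker * ∑ u, if u ∈ a.range then F u else 0 := by
  have h : ∀ u, (∑ x, if a x = u then F u else 0) =
      Nat.card a.ker * if u ∈ a.range then F u else 0 := by
    intro u
    by_cases hu : u ∈ a.range
    · obtain ⟨t, rfl⟩ := hu
      rw [if_pos ⟨t, rfl⟩, ← Equiv.sum_comp (Equiv.mulLeft t)]
      simp only [Equiv.coe_mulLeft, map_mul, mul_eq_left, ← MonoidHom.mem_ker]
      rw [← Finset.sum_filter, Finset.sum_const, nsmul_eq_mul, Nat.card_eq_fintype_card,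
        Fintype.card_subtype]
    · rw [if_neg hu, mul_zero, Finset.sum_eq_zero]
      intro x _
      rw [if_neg]
      rintro rfl
      exact hu ⟨x, rfl⟩
  rw [Finset.mul_sum]
  simp only [← h]
  rw [Finset.sum_comm]
  simp

theorem sum_transversal {U : Type} [Group U] [Fintype U] (A : Subgroup U)
    [DecidablePred (· ∈ A)] [Fintype (U ⧸ A)] (F : U → ℂ) :
    ∑ t : U ⧸ A, ∑ u, (if u ∈ A then F (t.out * u) else 0) = ∑ u, F u := by
  have h : ∀ t : U ⧸ A, (∑ u, if u ∈ A then F (t.out * u) else 0) =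
      ∑ u : U, if t = u then F u else 0 := by
    intro t
    rw [← Equiv.sum_comp (Equiv.mulLeft t.out⁻¹)]
    refine Finset.sum_congr rfl fun u _ => ?_
    simp only [Equiv.coe_mulLeft, mul_inv_cancel_left, ← QuotientGroup.eq,
      QuotientGroup.out_eq']
  simp only [h]
  rw [Finset.sum_comm]
  simp

end Sums

/-- An affine action of `G` on `ZMod n` whose linear part is a `2`-group and which contains the
translations. -/
structure IsAffine {n : ℕ} {G : Type} [Group G] (ρ : G →* Equiv.Perm (ZMod n))
    (a : G →* (ZMod n)ˣ) (b : G → ZMod n) : Prop where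
  apply : ∀ g x, ρ g x = a g * x + b g
  pow : ∃ k, ∀ g, a g ^ 2 ^ k = 1
  translation : ∃ c, a c = 1 ∧ b c = 1

section Prime

variable {p : ℕ} [Fact p.Prime]

theorem units_pow_eq_neg_one (k : ℕ) (u : (ZMod p)ˣ) (hu : u ≠ 1) (hk : u ^ 2 ^ k = 1) :
    ∃ m : ℕ, u ^ m = -1 := by
  induction k generalizing u with
  | zero => exact absurd (by simpa using hk) hu
  | succ k ih =>
    by_cases h : u ^ 2 = 1
    · refine ⟨1, ?_⟩
      have h1 : (u : ZMod p) ^ 2 = 1 := by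
        rw [← Units.val_pow_eq_pow_val, h, Units.val_one]
      rcases sq_eq_sq_iff_eq_or_eq_neg.1 (h1.trans (one_pow 2).symm) with h2 | h2
      · exact absurd (Units.ext h2) hu
      · rw [pow_one]
        exact Units.ext (by simpa using h2)
    · obtain ⟨m, hm⟩ := ih (u ^ 2) h (by rw [← pow_mul, ← pow_succ', hk])
      exact ⟨2 * m, by rw [pow_mul, hm]⟩

theorem sum_units_char (b : ZMod p) :
    ∑ u : (ZMod p)ˣ, (ZMod.stdAddChar ((u : ZMod p) * b) - 1 : ℂ) =
      (if b = 0 then (p : ℂ) else 0) - p := by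
  have h := AddChar.sum_mulShift b (ZMod.isPrimitive_stdAddChar p)
  have h2 : ∑ x : ZMod p, (ZMod.stdAddChar (x * b) - 1 : ℂ) =
      ∑ u : (ZMod p)ˣ, (ZMod.stdAddChar ((u : ZMod p) * b) - 1 : ℂ) := by
    symm
    refine Fintype.sum_of_injective (fun u : (ZMod p)ˣ => (u : ZMod p)) Units.val_injective _ _
      (fun x hx => ?_) fun _ => rfl
    have : x = 0 := by
      by_contra h0
      exact hx ⟨Units.mk0 x h0, rfl⟩
    simp [this]
  rw [← h2, Finset.sum_sub_distrib, h]
  simp [ZMod.card]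

theorem sign_addRight (hp : Odd p) (b : ZMod p) : Equiv.Perm.sign (Equiv.addRight b) = 1 := by
  have h : ∀ n : ℕ, (Equiv.addRight b : Equiv.Perm (ZMod p)) ^ n = Equiv.addRight (n * b) := by
    intro n
    induction n with
    | zero => ext; simp
    | succ n ih =>
      rw [pow_succ, ih]
      ext x
      simp only [Equiv.Perm.mul_apply, Equiv.coe_addRight]
      push_cast
      ring_nf
  have h1 : Equiv.Perm.sign (Equiv.addRight b : Equiv.Perm (ZMod p)) ^ p = 1 := by
    rw [← map_pow, h]
    have : (Equiv.addRight ((p : ZMod p) * b) : Equiv.Perm (ZMod p)) = 1 := by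
      ext x
      simp
    rw [this, map_one]
  rcases Int.units_eq_one_or (Equiv.Perm.sign (Equiv.addRight b : Equiv.Perm (ZMod p)))
    with h2 | h2
  · exact h2
  · rw [h2, hp.neg_one_pow] at h1
    exact absurd h1 (by decide)

variable {G : Type} [Group G]

/-- The action on the units of `ZMod p` through a homomorphism to the units. -/
def mulPerm (a : G →* (ZMod p)ˣ) : G →* Equiv.Perm (ZMod p)ˣ :=
  (MulAction.toPermHom (ZMod p)ˣ (ZMod p)ˣ).comp a

theorem mulPerm_apply (a : G →* (ZMod p)ˣ) (g : G) (u : (ZMod p)ˣ) :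
    mulPerm a g u = a g * u := rfl

namespace IsAffine

variable {ρ : G →* Equiv.Perm (ZMod p)} {a : G →* (ZMod p)ˣ} {b : G → ZMod p}

theorem sgn_eq (h : IsAffine ρ a b) (hp : Odd p) : sgn ρ = sgn (mulPerm a) := by
  ext1 g
  let f : (ZMod p)ˣ ≃ {x : ZMod p // x ≠ 0} := unitsEquivNeZero
  have h1 : ρ g = Equiv.addRight (b g) * (mulPerm a g).extendDomain f := by
    ext1 x
    rw [h.apply, Equiv.Perm.mul_apply, Equiv.coe_addRight]
    congr 1
    by_cases hx : x = 0
    · rw [Equiv.Perm.extendDomain_apply_not_subtype _ _ (by simpa using hx), hx, mul_zero]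
    · have := (mulPerm a g).extendDomain_apply_image f (Units.mk0 x hx)
      exact this.symm
  rw [sgn_apply, h1, map_mul, sign_addRight hp, one_mul, Equiv.Perm.sign_extendDomain,
    sgn_apply]

theorem permChar_of_eq_one (h : IsAffine ρ a b) {g : G} (hg : a g = 1) :
    permChar ρ g - 1 - permChar (mulPerm a) g = (if b g = 0 then (p : ℂ) else 0) - p := by
  simp only [permChar, h.apply, mulPerm_apply, hg, Units.val_one, one_mul, add_eq_left]
  have hp : 1 ≤ p := (Fact.out : p.Prime).one_le
  have hc : Fintype.card (ZMod p)ˣ = p - 1 := ZMod.card_units p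
  split_ifs
  · simp [ZMod.card, hc, Nat.cast_sub hp]
  · simp [hc, Nat.cast_sub hp]
    ring

theorem permChar_of_ne_one (h : IsAffine ρ a b) {g : G} (hg : a g ≠ 1) :
    permChar ρ g - 1 - permChar (mulPerm a) g = 0 := by
  have h1 : permChar (mulPerm a) g = 0 := by
    simp [permChar, mulPerm_apply, hg]
  have hne : (1 - a g : ZMod p) ≠ 0 := fun h0 => hg (Units.ext (sub_eq_zero.1 h0).symm)
  have h2 : ∀ x, ρ g x = x ↔ x = (1 - a g : ZMod p)⁻¹ * b g := by
    intro x
    rw [h.apply, eq_inv_mul_iff_mul_eq₀ hne]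
    constructor
    · intro hx
      linear_combination -hx
    · intro hx
      linear_combination -hx
  rw [h1, permChar]
  simp [h2]

theorem b_eq (h : IsAffine ρ a b) (g : G) : b g = ρ g 0 := by rw [h.apply, mul_zero, zero_add]

theorem b_mul (h : IsAffine ρ a b) (g g' : G) : b (g * g') = a g * b g' + b g := by
  rw [h.b_eq, map_mul, Equiv.Perm.mul_apply, h.apply, ← h.b_eq]

theorem b_one (h : IsAffine ρ a b) : b 1 = 0 := by
  rw [h.b_eq, map_one, Equiv.Perm.one_apply]

theorem b_conj (h : IsAffine ρ a b) {g : G} (hg : a g = 1) (x : G) :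
    b (x⁻¹ * g * x) = ((a x)⁻¹ : (ZMod p)ˣ) * b g := by
  have h1 : b (x * (x⁻¹ * g * x)) = b (g * x) := by simp [mul_assoc]
  rw [h.b_mul x, h.b_mul g, hg, Units.val_one, one_mul, add_comm, add_right_inj] at h1
  rw [Units.eq_inv_mul_iff_mul_eq, h1]

theorem mem_zpowers_neg_one (u : (ZMod p)ˣ) :
    u ∈ Subgroup.zpowers (-1 : (ZMod p)ˣ) ↔ u = 1 ∨ u = -1 := by
  constructor
  · rintro ⟨k, rfl⟩
    rcases Int.even_or_odd k with hk | hk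
    · exact Or.inl hk.neg_one_zpow
    · exact Or.inr hk.neg_one_zpow
  · rintro (rfl | rfl)
    · exact one_mem _
    · exact Subgroup.mem_zpowers _

theorem two_ne_zero_of_odd (hp : Odd p) : (2 : ZMod p) ≠ 0 := by
  intro h
  have h1 : ((2 : ℕ) : ZMod p) = 0 := by exact_mod_cast h
  rw [ZMod.natCast_eq_zero_iff, Nat.prime_dvd_prime_iff_eq Fact.out Nat.prime_two] at h1
  subst h1
  exact absurd hp (by decide)

theorem one_ne_neg_one (hp : Odd p) : (1 : (ZMod p)ˣ) ≠ -1 := by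
  intro h
  have h1 : (1 : ZMod p) = -1 := by simpa using congrArg Units.val h
  exact two_ne_zero_of_odd hp (by linear_combination h1)

theorem sum_zpowers_neg_one (hp : Odd p) (F : (ZMod p)ˣ → ℂ) :
    ∑ u, (if u ∈ Subgroup.zpowers (-1 : (ZMod p)ˣ) then F u else 0) = F 1 + F (-1) := by
  simp only [mem_zpowers_neg_one]
  rw [← Finset.sum_filter]
  have : (Finset.univ.filter fun u : (ZMod p)ˣ => u = 1 ∨ u = -1) = {1, -1} := by
    ext u
    simp
  rw [this, Finset.sum_pair (one_ne_neg_one hp)]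

variable [Fintype G]

theorem sub_mem_P_of_trivial (h : IsAffine ρ a b) (hp : Odd p) (ha : ∀ g, a g = 1) :
    (fun g => permChar ρ g - 1 - permChar (mulPerm a) g) ∈ P G := by
  let χ (t : (ZMod p)ˣ) : G →* ℂ :=
    { toFun := fun g => ZMod.stdAddChar ((t : ZMod p) * b g)
      map_one' := by rw [h.b_one, mul_zero, AddChar.map_zero_eq_one]
      map_mul' := fun g g' => by
        rw [h.b_mul, ha, Units.val_one, one_mul, mul_add, AddChar.map_add_eq_mul, mul_comm] }
  have hχ (t : (ZMod p)ˣ) (g : G) : χ t g = ZMod.stdAddChar ((t : ZMod p) * b g) := rfl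
  have hmem (t : (ZMod p)ˣ ⧸ Subgroup.zpowers (-1 : (ZMod p)ˣ)) :
      ((χ t.out : G → ℂ) - 1) + conjFun ((χ t.out : G → ℂ) - 1) ∈ P G :=
    mem_P.2 (memP.conj_add _ ((isGenChar_linear _).sub isGenChar_one) (by simp))
  convert (P G).sum_mem (t := Finset.univ) fun t _ => hmem t using 1
  funext g
  rw [h.permChar_of_eq_one (ha g), ← sum_units_char, ← sum_transversal
    (Subgroup.zpowers (-1 : (ZMod p)ˣ)) (fun u => ZMod.stdAddChar ((u : ZMod p) * b g) - 1),
    Finset.sum_apply]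
  refine Finset.sum_congr rfl fun t _ => ?_
  rw [sum_zpowers_neg_one hp]
  simp [conjFun, hχ, AddChar.map_neg_eq_conj]

theorem sub_mem_P_of_neg_one (h : IsAffine ρ a b) (hp : Odd p) {s : G} (hs : a s = -1) :
    (fun g => permChar ρ g - 1 - permChar (mulPerm a) g) ∈ P G := by
  set K : Subgroup G := (Subgroup.zpowers (-1 : (ZMod p)ˣ)).comap a with hK
  have hmemK : ∀ g, g ∈ K ↔ a g = 1 ∨ a g = -1 := fun g => by
    rw [hK, Subgroup.mem_comap, mem_zpowers_neg_one]
  obtain ⟨φ, hφ⟩ := exists_dihedral_lift (two_ne_zero_of_odd hp) (ρ.comp K.subtype) fun g => by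
    refine ⟨b g, ?_⟩
    rcases (hmemK g).1 g.2 with hg | hg
    · left
      intro x
      simp [h.apply, hg]
    · right
      intro x
      simp [h.apply, hg]
  have hφ' : ∀ (g : K) x, dihedralPerm (φ g) x = a g * x + b g := fun g x => by
    rw [hφ, ← h.apply]
    rfl
  have hr : ∀ g : K, a g = 1 → φ g = .r (b g) := by
    intro g hg
    apply dihedralPerm_injective (two_ne_zero_of_odd hp)
    ext1 x
    rw [hφ', hg, dihedralPerm_r, Units.val_one, one_mul]
  have hsr : ∀ g : K, a g = -1 → φ g = .sr (-b g) := by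
    intro g hg
    apply dihedralPerm_injective (two_ne_zero_of_odd hp)
    ext1 x
    rw [hφ', hg, dihedralPerm_sr]
    simp [add_comm]
  have hsurj : Function.Surjective φ := by
    obtain ⟨c, hc1, hc2⟩ := h.translation
    let c' : K := ⟨c, (hmemK c).2 (Or.inl hc1)⟩
    let s' : K := ⟨s, (hmemK s).2 (Or.inr hs)⟩
    have h1 : ∀ i : ZMod p, φ (c' ^ i.val) = .r i := fun i => by
      rw [map_pow, hr c' hc1, show b c' = 1 from hc2, DihedralGroup.r_one_pow,
        ZMod.natCast_zmod_val]
    intro d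
    rcases d with i | i
    · exact ⟨_, h1 i⟩
    · exact ⟨s' * c' ^ (i + b s).val, by
        rw [map_mul, h1, hsr s' hs, DihedralGroup.sr_mul_r, neg_add_cancel_comm_assoc]⟩
  have hmem (t : (ZMod p)ˣ ⧸ a.range) :
      indChar K (fun g => dihedralFun (AddChar.mulShift ZMod.stdAddChar (t.out : ZMod p)) (φ g))
        ∈ P G :=
    indChar_dihedral_mem_P K (Or.inr (Or.inr ⟨p, hp, Fact.out, ⟨MulEquiv.refl _⟩⟩)) φ hsurj _
  have hKcard : (Nat.card K : ℂ) = Nat.card a.ker * 2 := by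
    have h1 := sum_comp_hom a fun u => if u ∈ Subgroup.zpowers (-1 : (ZMod p)ˣ) then (1 : ℂ) else 0
    have h2 : ∀ u, (if u ∈ a.range then
        (if u ∈ Subgroup.zpowers (-1 : (ZMod p)ˣ) then (1 : ℂ) else 0) else 0) =
        if u ∈ Subgroup.zpowers (-1 : (ZMod p)ˣ) then 1 else 0 := by
      intro u
      by_cases hu : u ∈ Subgroup.zpowers (-1 : (ZMod p)ˣ)
      · have : u ∈ a.range := (Subgroup.zpowers_le (H := a.range)).2 ⟨s, hs⟩ hu
        rw [if_pos this]
      · rw [if_neg hu, ite_self]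
    simp only [h2] at h1
    rw [sum_zpowers_neg_one hp, one_add_one_eq_two] at h1
    rw [← h1, Finset.sum_boole, Nat.card_eq_fintype_card, Fintype.card_subtype]
    rfl
  have hker : (Nat.card a.ker : ℂ) ≠ 0 := Nat.cast_ne_zero.2 Nat.card_pos.ne'
  convert (P G).sum_mem (t := Finset.univ) fun t _ => hmem t using 1
  funext g
  rw [Finset.sum_apply]
  have hconj : ∀ x, a (x⁻¹ * g * x) = a g := fun x => by
    rw [map_mul, map_mul, map_inv, mul_right_comm, inv_mul_cancel, one_mul]
  by_cases hg : a g = 1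
  · have hF : ∀ t u : (ZMod p)ˣ, ∀ x, dihedralFun (AddChar.mulShift ZMod.stdAddChar (t : ZMod p))
        (.r (((u⁻¹ : (ZMod p)ˣ) : ZMod p) * b x)) =
        (ZMod.stdAddChar (((t * u⁻¹ : (ZMod p)ˣ) : ZMod p) * b x) - 1 : ℂ) +
        (ZMod.stdAddChar (((-(t * u⁻¹) : (ZMod p)ˣ) : ZMod p) * b x) - 1) := by
      intro t u x
      rw [dihedralFun_r, AddChar.mulShift_apply, AddChar.mulShift_apply]
      push_cast
      rw [mul_neg, neg_mul, mul_assoc]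
      ring
    have hind : ∀ t : (ZMod p)ˣ ⧸ a.range, indChar K (fun g => dihedralFun
        (AddChar.mulShift ZMod.stdAddChar (t.out : ZMod p)) (φ g)) g =
        2⁻¹ * ∑ u, if u ∈ a.range then
          ((ZMod.stdAddChar (((t.out * u : (ZMod p)ˣ) : ZMod p) * b g) - 1 : ℂ) +
          (ZMod.stdAddChar (((-(t.out * u) : (ZMod p)ˣ) : ZMod p) * b g) - 1)) else 0 := by
      intro t
      rw [indChar_apply, hKcard, mul_inv, mul_comm (_)⁻¹ (2 : ℂ)⁻¹, mul_assoc]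
      congr 1
      rw [inv_mul_eq_iff_eq_mul₀ hker, ← sum_comp_hom a (fun u =>
        (ZMod.stdAddChar (((t.out * u : (ZMod p)ˣ) : ZMod p) * b g) - 1 : ℂ) +
          (ZMod.stdAddChar (((-(t.out * u) : (ZMod p)ˣ) : ZMod p) * b g) - 1)),
        ← Equiv.sum_comp (Equiv.inv G)]
      refine Finset.sum_congr rfl fun x _ => ?_
      have hx : a ((Equiv.inv G x)⁻¹ * g * Equiv.inv G x) = 1 := by rw [hconj, hg]
      rw [extendZero_of_mem _ ((hmemK _).2 (Or.inl hx)), hr _ hx]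
      simp only [h.b_conj hg, hF]
      simp
    have hneg : ∑ u : (ZMod p)ˣ, (ZMod.stdAddChar (((-u : (ZMod p)ˣ) : ZMod p) * b g) - 1 : ℂ) =
        ∑ u : (ZMod p)ˣ, (ZMod.stdAddChar ((u : ZMod p) * b g) - 1 : ℂ) :=
      Equiv.sum_comp (Equiv.neg (ZMod p)ˣ)
        (fun u : (ZMod p)ˣ => (ZMod.stdAddChar ((u : ZMod p) * b g) - 1 : ℂ))
    simp only [hind]
    rw [← Finset.mul_sum, sum_transversal a.range (fun u =>
        (ZMod.stdAddChar ((u : ZMod p) * b g) - 1 : ℂ) +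
          (ZMod.stdAddChar (((-u : (ZMod p)ˣ) : ZMod p) * b g) - 1)), Finset.sum_add_distrib,
      hneg, h.permChar_of_eq_one hg, ← sum_units_char]
    ring
  · rw [h.permChar_of_ne_one hg, Finset.sum_eq_zero]
    intro t _
    rw [indChar_apply, Finset.sum_eq_zero, mul_zero]
    intro x _
    by_cases hx : x⁻¹ * g * x ∈ K
    · rw [extendZero_of_mem _ hx, hsr, dihedralFun_sr]
      exact ((hmemK _).1 hx).resolve_left (by rwa [hconj])
    · rw [extendZero_of_notMem _ hx]

theorem defect_mem_P (h : IsAffine ρ a b) (hp : Odd p) (hU : defect (mulPerm a) ∈ P G) :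
    defect ρ ∈ P G := by
  have key : (fun g => permChar ρ g - 1 - permChar (mulPerm a) g) ∈ P G := by
    by_cases ha : ∀ g, a g = 1
    · exact h.sub_mem_P_of_trivial hp ha
    · push Not at ha
      obtain ⟨g, hg⟩ := ha
      obtain ⟨k, hk⟩ := h.pow
      obtain ⟨m, hm⟩ := units_pow_eq_neg_one k (a g) hg (hk g)
      exact h.sub_mem_P_of_neg_one hp (s := g ^ m) (by rw [map_pow, hm])
  convert (P G).add_mem key hU using 1
  funext g
  have hp1 : 1 ≤ p := (Fact.out : p.Prime).one_le
  simp only [defect, Pi.add_apply, h.sgn_eq hp, ZMod.card, ZMod.card_units, Nat.cast_sub hp1]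
  push_cast
  ring

end IsAffine

end Prime

section Reductions

variable {G : Type} [Group G] {X : Type}

/-- The permutation representation on an invariant subset. -/
def restrictPerm (ρ : G →* Equiv.Perm X) (S : X → Prop) (hS : ∀ g x, S (ρ g x) ↔ S x) :
    G →* Equiv.Perm {x // S x} where
  toFun g := (ρ g).subtypePerm fun x => hS g x
  map_one' := by
    ext x
    simp
  map_mul' g h := by
    ext x
    simp
    rfl

theorem orbit_invariant (ρ : G →* Equiv.Perm X) (x₀ : X) (g : G) (x : X) :
    (∃ k, ρ k x₀ = ρ g x) ↔ ∃ k, ρ k x₀ = x := by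
  constructor
  · rintro ⟨k, hk⟩
    exact ⟨g⁻¹ * k, by
      rw [map_mul, Equiv.Perm.mul_apply, hk, map_inv, Equiv.Perm.inv_eq_iff_eq]⟩
  · rintro ⟨k, hk⟩
    exact ⟨g * k, by rw [map_mul, Equiv.Perm.mul_apply, hk]⟩

/-- The stabiliser of a point in a permutation representation. -/
def stab (ρ : G →* Equiv.Perm X) (x : X) : Subgroup G where
  carrier := {g | ρ g x = x}
  one_mem' := by simp
  mul_mem' {g h} hg hh := by
    simp only [Set.mem_ofPred_eq] at *
    rw [map_mul, Equiv.Perm.mul_apply, hh, hg]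
  inv_mem' {g} hg := by
    simp only [Set.mem_ofPred_eq] at *
    rw [map_inv, Equiv.Perm.inv_eq_iff_eq, hg]

theorem mem_stab {ρ : G →* Equiv.Perm X} {x : X} {g : G} : g ∈ stab ρ x ↔ ρ g x = x := Iff.rfl

theorem fibre_invariant {B : Type} {ρX : G →* Equiv.Perm X} {ρB : G →* Equiv.Perm B} {q : X → B}
    (hq : ∀ g x, q (ρX g x) = ρB g (q x)) (b₀ : B) (m : stab ρB b₀) (x : X) :
    q (ρX.comp (stab ρB b₀).subtype m x) = b₀ ↔ q x = b₀ := by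
  have : ρB m b₀ = b₀ := mem_stab.1 m.2
  rw [MonoidHom.comp_apply, hq]
  exact ⟨fun h => (ρB m).injective (h.trans this.symm), fun h => h ▸ this⟩

theorem isFib_fibre {B : Type} {ρX : G →* Equiv.Perm X} {ρB : G →* Equiv.Perm B} {q : X → B}
    (hq : ∀ g x, q (ρX g x) = ρB g (q x)) (b₀ : B) (hB : ∀ b, ∃ g, ρB g b₀ = b) :
    IsFib ρX ρB q b₀ (stab ρB b₀)
      (restrictPerm (ρX.comp (stab ρB b₀).subtype) (fun x => q x = b₀) (fibre_invariant hq b₀))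
      Subtype.val where
  equivariant := hq
  mem_iff _ := Iff.rfl
  transitive := hB
  injective := Subtype.val_injective
  fibre x := ⟨fun h => ⟨⟨x, h⟩, rfl⟩, by rintro ⟨y, rfl⟩; exact y.2⟩
  action _ _ := rfl

variable [Fintype G]

/-- All permutation representations of `G` have defect in `P G`. -/
def AllGood (G : Type) [Group G] [Fintype G] : Prop :=
  ∀ (X : Type) [Fintype X] (ρ : G →* Equiv.Perm X), defect ρ ∈ P G

variable [Fintype X]

theorem defect_mem_P_of_map {B : Type} [Fintype B] {ρX : G →* Equiv.Perm X}
    {ρB : G →* Equiv.Perm B} {q : X → B}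
    (hq : ∀ g x, q (ρX g x) = ρB g (q x)) (b₀ : B) (htr : ∀ b, ∃ g, ρB g b₀ = b)
    (hY : AllGood (stab ρB b₀)) (hB : defect ρB ∈ P G)
    (hZ : ∀ σ : G →* Equiv.Perm (B × ℤˣ), (∀ g z, (σ g z).1 = ρB g z.1) → defect σ ∈ P G) :
    defect ρX ∈ P G :=
  (isFib_fibre hq b₀ htr).defect_mem_P (hY _ _) hB hZ

theorem defect_mem_P_of_not_transitive (ρ : G →* Equiv.Perm X) (x₀ : X)
    (hρ : ¬ ∀ x, ∃ g, ρ g x₀ = x)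
    (ih : ∀ (Y : Type) [Fintype Y] (σ : G →* Equiv.Perm Y), Fintype.card Y < Fintype.card X →
      defect σ ∈ P G) : defect ρ ∈ P G := by
  push Not at hρ
  obtain ⟨y₀, hy₀⟩ := hρ
  let S : X → Prop := fun x => ∃ g, ρ g x₀ = x
  have hS : ∀ g x, S (ρ g x) ↔ S x := orbit_invariant ρ x₀
  refine defect_sum_mem_P (ρ := restrictPerm ρ S hS)
    (σ := restrictPerm ρ (fun x => ¬ S x) fun g x => not_congr (hS g x)) (Equiv.sumCompl S)
    (fun g x => rfl) (fun g x => rfl) (ih _ _ ?_) (ih _ _ ?_)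
  · refine Fintype.card_subtype_lt (x := y₀) ?_
    rintro ⟨g, hg⟩
    exact hy₀ g hg
  · refine Fintype.card_subtype_lt (x := x₀) fun h => h ⟨1, by simp⟩

theorem defect_mem_P_of_character (ρ : G →* Equiv.Perm X) (x₀ : X)
    (htr : ∀ x, ∃ g, ρ g x₀ = x) (η : G →* ℤˣ) (hη : ∀ g, ρ g x₀ = x₀ → η g = 1)
    (hne : ∃ g, η g = -1) (ih : ∀ M : Subgroup G, M ≠ ⊤ → AllGood M) : defect ρ ∈ P G := by
  choose t ht using htr
  have hq : ∀ g x, η (t (ρ g x)) = unitsPerm η g (η (t x)) := by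
    intro g x
    have : η ((t (ρ g x))⁻¹ * (g * t x)) = 1 := hη _ (by
      rw [map_mul, Equiv.Perm.mul_apply, map_mul, Equiv.Perm.mul_apply, ht, map_inv,
        Equiv.Perm.inv_eq_iff_eq, ht])
    rw [map_mul, map_inv, inv_mul_eq_one, map_mul] at this
    rw [unitsPerm_apply, this]
  obtain ⟨s, hs⟩ := hne
  refine defect_mem_P_of_map (q := fun x => η (t x)) hq 1 (fun b => ?_) (ih _ fun htop => ?_) ?_
    fun σ hσ => defect_mem_P_of_units_prod σ η hσ
  · rcases Int.units_eq_one_or b with rfl | rfl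
    · exact ⟨1, by simp⟩
    · exact ⟨s, by rw [unitsPerm_apply, hs, mul_one]⟩
  · have : s ∈ stab (unitsPerm η) 1 := htop ▸ Subgroup.mem_top s
    rw [mem_stab, unitsPerm_apply, hs] at this
    exact absurd this (by decide)
  · rw [defect_unitsPerm]
    exact (P G).zero_mem

end Reductions

section Affine

variable {n : ℕ} {G : Type} [Group G] {ρ : G →* Equiv.Perm (ZMod n)} {a : G →* (ZMod n)ˣ}
  {b : G → ZMod n}

theorem IsAffine.pow_translation (h : IsAffine ρ a b) {c : G} (hc : a c = 1) (hb : b c = 1)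
    (k : ℕ) (x : ZMod n) : ρ (c ^ k) x = x + k := by
  induction k with
  | zero => simp
  | succ k ih =>
    rw [pow_succ', map_mul, Equiv.Perm.mul_apply, ih, h.apply, hc, hb, Units.val_one, one_mul]
    push_cast
    ring

/-- The reduction of an affine action modulo a divisor. -/
def affineReduction (h : IsAffine ρ a b) (d : ℕ) (hd : d ∣ n) : G →* Equiv.Perm (ZMod d) :=
  MonoidHom.toHomPerm
    { toFun := fun g =>
        (fun x => ZMod.castHom hd (ZMod d) (a g) * x + ZMod.castHom hd (ZMod d) (b g) :
          ZMod d → ZMod d)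
      map_one' := by
        have h1 : b 1 = 0 := by
          have := h.apply 1 0
          simpa using this.symm
        funext x
        change ZMod.castHom hd (ZMod d) (a 1) * x + ZMod.castHom hd (ZMod d) (b 1) = x
        rw [h1, map_one a, Units.val_one, map_one, map_zero, one_mul, add_zero]
      map_mul' := fun g g' => by
        have h1 : b (g * g') = a g * b g' + b g := by
          have := h.apply (g * g') 0
          rw [map_mul, Equiv.Perm.mul_apply, h.apply, h.apply] at this
          simpa using this.symm
        funext x
        rw [h1]
        change _ = ZMod.castHom hd (ZMod d) (a g) * (ZMod.castHom hd (ZMod d) (a g') * x +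
          ZMod.castHom hd (ZMod d) (b g')) + ZMod.castHom hd (ZMod d) (b g)
        rw [map_mul, Units.val_mul, map_mul, map_add, map_mul]
        ring }

theorem affineReduction_apply (h : IsAffine ρ a b) (d : ℕ) (hd : d ∣ n) (g : G) (x : ZMod n) :
    ZMod.castHom hd (ZMod d) (ρ g x) = affineReduction h d hd g (ZMod.castHom hd (ZMod d) x) := by
  rw [h.apply, map_add, map_mul]
  rfl

theorem IsAffine.defect_mem_P_of_odd [Fintype G] [NeZero n] (h : IsAffine ρ a b) (hn : Odd n)
    (ihG : ∀ M : Subgroup G, M ≠ ⊤ → AllGood M)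
    (ihX : ∀ (Y : Type) [Fintype Y] (σ : G →* Equiv.Perm Y), Fintype.card Y < n →
      defect σ ∈ P G) : defect ρ ∈ P G := by
  rcases eq_or_ne n 1 with rfl | hn1
  · have : Subsingleton (ZMod 1) := inferInstanceAs (Subsingleton (Fin 1))
    exact defect_mem_P_of_subsingleton ρ
  by_cases hp : n.Prime
  · have : Fact n.Prime := ⟨hp⟩
    refine h.defect_mem_P hn (ihX _ _ ?_)
    rw [ZMod.card_units]
    exact Nat.sub_lt hp.pos one_pos
  obtain ⟨c, hc, hb⟩ := h.translation
  obtain ⟨d, hd⟩ := n.minFac_dvd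
  have hn0 : n ≠ 0 := NeZero.ne n
  have hr3 : 3 ≤ n.minFac := by
    have h1 := (n.minFac_prime hn1).two_le
    have h2 : n.minFac ≠ 2 := fun h2 => by
      have := n.minFac_dvd
      rw [h2] at this
      exact (Nat.not_even_iff_odd.2 hn) (even_iff_two_dvd.2 this)
    omega
  have hd0 : 0 < d := by
    rcases Nat.eq_zero_or_pos d with h0 | h0
    · rw [h0, mul_zero] at hd
      exact absurd hd hn0
    · exact h0
  have hd1 : d ≠ 1 := by
    rintro rfl
    rw [mul_one] at hd
    exact hp (hd ▸ n.minFac_prime hn1)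
  have h2d : 2 * d < n := by
    rw [hd]
    nlinarith
  have hdn : d ∣ n := ⟨n.minFac, by rw [mul_comm]; exact hd⟩
  have : NeZero d := ⟨hd0.ne'⟩
  have hk : ∀ k : ℕ, affineReduction h d hdn (c ^ k) 0 = k := fun k => by
    rw [← map_zero (ZMod.castHom hdn (ZMod d)), ← affineReduction_apply,
      h.pow_translation hc hb, zero_add, map_natCast]
  refine defect_mem_P_of_map (affineReduction_apply h d hdn) 0 (fun x => ?_) (ihG _ fun htop => ?_)
    (ihX _ _ ?_) fun σ _ => ihX _ _ ?_
  · exact ⟨c ^ x.val, by rw [hk, ZMod.natCast_zmod_val]⟩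
  · have hmem : c ∈ stab (affineReduction h d hdn) 0 := htop ▸ Subgroup.mem_top c
    have h1 := hk 1
    rw [pow_one, mem_stab.1 hmem, Nat.cast_one] at h1
    have : Fact (1 < d) := ⟨by omega⟩
    exact zero_ne_one h1
  · rw [ZMod.card]
    omega
  · rw [Fintype.card_prod, ZMod.card, Fintype.card_units_int]
    omega

end Affine

section Hyp

variable {G : Type} [Group G]

/-- A group that is an extension of a `2`-group by a cyclic group of odd order. -/
def IsHyp (G : Type) [Group G] : Prop :=
  ∃ C : Subgroup G, C.Normal ∧ IsCyclic C ∧ Odd (Nat.card C) ∧ ∃ k, C.index = 2 ^ k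

theorem IsHyp.of_injective (h : IsHyp G) {K : Type} [Group K] (f : K →* G)
    (hf : Function.Injective f) : IsHyp K := by
  obtain ⟨C, hN, hc, ho, k, hk⟩ := h
  let φ : C.comap f →* C := (f.comp (C.comap f).subtype).codRestrict C fun x => x.2
  have hφ : Function.Injective φ := fun x y hxy =>
    Subtype.ext (hf (congrArg (Subtype.val : C → G) hxy))
  refine ⟨C.comap f, inferInstance, isCyclic_of_injective φ hφ,
    ho.of_dvd_nat (Subgroup.card_dvd_of_injective φ hφ), ?_⟩
  obtain ⟨j, -, hj⟩ := (Nat.dvd_prime_pow Nat.prime_two).1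
    (hk ▸ Subgroup.relIndex_dvd_index_of_normal C f.range)
  exact ⟨j, by rw [Subgroup.index_comap, hj]⟩

theorem exists_index_two_of_isPGroup [Finite G] (hG : IsPGroup 2 G) {K : Subgroup G}
    (hK : K ≠ ⊤) : ∃ L : Subgroup G, L.index = 2 ∧ K ≤ L := by
  obtain ⟨k, hk⟩ := IsPGroup.iff_card.1 hG
  obtain ⟨n, hn⟩ := IsPGroup.iff_card.1 (hG.to_subgroup K)
  have hnk : n < k := by
    by_contra! hle
    refine hK (Subgroup.eq_top_of_le_card K ?_)
    rw [hk, hn]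
    exact Nat.pow_le_pow_right two_pos hle
  obtain ⟨L, hL, hKL⟩ := Sylow.exists_subgroup_card_pow_prime_le (m := k - 1) 2
    (by rw [hk]; exact pow_dvd_pow 2 (Nat.sub_le k 1)) K hn (by omega)
  refine ⟨L, ?_, hKL⟩
  have h := L.card_mul_index
  rw [hL, hk, ← Nat.sub_add_cancel (show 1 ≤ k by omega), Nat.add_sub_cancel, pow_succ] at h
  exact Nat.eq_of_mul_eq_mul_left (by positivity) h

/-- The sign character of a subgroup of index two. -/
def indexTwoSign {L : Subgroup G} (hL : L.index = 2) : G →* ℤˣ where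
  toFun g := if g ∈ L then 1 else -1
  map_one' := if_pos L.one_mem
  map_mul' g h := by
    have := Subgroup.mul_mem_iff_of_index_two hL (a := g) (b := h)
    by_cases h1 : g ∈ L <;> by_cases h2 : h ∈ L <;> simp [this, h1, h2]

theorem exists_character [Finite G] {C H : Subgroup G} [C.Normal] {k : ℕ} (hk : C.index = 2 ^ k)
    (hHC : H ⊔ C ≠ ⊤) : ∃ η : G →* ℤˣ, (∀ g ∈ H, η g = 1) ∧ ∃ g, η g = -1 := by
  have hQ : IsPGroup 2 (G ⧸ C) := IsPGroup.iff_card.2 ⟨k, hk⟩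
  have hK : H.map (QuotientGroup.mk' C) ≠ ⊤ := fun h => hHC (by
    have := congrArg (Subgroup.comap (QuotientGroup.mk' C)) h
    rwa [Subgroup.comap_map_eq, QuotientGroup.ker_mk', Subgroup.comap_top] at this)
  obtain ⟨L, hL, hle⟩ := exists_index_two_of_isPGroup hQ hK
  have hL' : (L.comap (QuotientGroup.mk' C)).index = 2 := by
    rw [Subgroup.index_comap_of_surjective _ (QuotientGroup.mk'_surjective C), hL]
  refine ⟨indexTwoSign hL', fun g hg => if_pos (hle ⟨g, hg, rfl⟩), ?_⟩
  have hne : L.comap (QuotientGroup.mk' C) ≠ ⊤ := fun h => by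
    rw [h, Subgroup.index_top] at hL'
    exact absurd hL' (by decide)
  obtain ⟨g, hg⟩ := not_forall.1 (mt (Subgroup.eq_top_iff' _).2 hne)
  exact ⟨g, if_neg hg⟩

end Hyp

section CyclicAction

variable {G : Type} [Group G] {X : Type} [Fintype X]

/-- Numbering of a set permuted transitively by a single permutation. -/
def cycleFun (τ : Equiv.Perm X) (x₀ : X) : ZMod (Fintype.card X) → X :=
  fun z => (τ ^ z.val) x₀

variable {τ : Equiv.Perm X} {x₀ : X}

theorem isCycleOn_of_forall_exists (hτ : ∀ x, ∃ k : ℤ, (τ ^ k) x₀ = x) :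
    τ.IsCycleOn (Finset.univ : Finset X) := by
  refine ⟨by simp, fun x _ y _ => ?_⟩
  exact (show τ.SameCycle x₀ x from hτ x).symm.trans (hτ y)

variable [Nonempty X]

theorem cycleFun_intCast (hτ : ∀ x, ∃ k : ℤ, (τ ^ k) x₀ = x) (k : ℤ) :
    cycleFun τ x₀ k = (τ ^ k) x₀ := by
  have : NeZero (Fintype.card X) := ⟨Fintype.card_ne_zero⟩
  rw [cycleFun, ← zpow_natCast,
    (isCycleOn_of_forall_exists hτ).zpow_apply_eq_zpow_apply (Finset.mem_univ x₀),
    Finset.card_univ, ← ZMod.intCast_eq_intCast_iff]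
  simp

theorem cycleFun_bijective (hτ : ∀ x, ∃ k : ℤ, (τ ^ k) x₀ = x) :
    Function.Bijective (cycleFun τ x₀) := by
  have : NeZero (Fintype.card X) := ⟨Fintype.card_ne_zero⟩
  rw [Fintype.bijective_iff_surjective_and_card, ZMod.card]
  refine ⟨fun x => ?_, rfl⟩
  obtain ⟨k, hk⟩ := hτ x
  exact ⟨k, by rw [cycleFun_intCast hτ, hk]⟩

theorem exists_isAffine (ρ : G →* Equiv.Perm X) (x₀ : X) (c : G) {k : ℕ}
    (hN : (Subgroup.zpowers c).Normal) (hk : (Subgroup.zpowers c).index = 2 ^ k)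
    (htr : ∀ x, ∃ k : ℤ, ((ρ c) ^ k) x₀ = x) :
    ∃ (e : ZMod (Fintype.card X) ≃ X) (σ : G →* Equiv.Perm (ZMod (Fintype.card X)))
      (a : G →* (ZMod (Fintype.card X))ˣ) (b : G → ZMod (Fintype.card X)),
      (∀ g z, e (σ g z) = ρ g (e z)) ∧ IsAffine σ a b := by
  let e := Equiv.ofBijective _ (cycleFun_bijective htr)
  have he : ∀ k : ℤ, e (k : ZMod _) = (ρ c ^ k) x₀ := cycleFun_intCast htr
  let σ : G →* Equiv.Perm (ZMod (Fintype.card X)) := e.symm.permCongrHom.toMonoidHom.comp ρ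
  have hσ : ∀ g z, e (σ g z) = ρ g (e z) := fun g z => e.apply_symm_apply _
  let A : G → ZMod (Fintype.card X) := fun g => σ g 1 - σ g 0
  have hA : ∀ g z, σ g z = A g * z + σ g 0 := by
    intro g
    obtain ⟨j, hj⟩ := Subgroup.mem_zpowers_iff.1 (hN.conj_mem c (Subgroup.mem_zpowers c) g)
    obtain ⟨w, hw⟩ := ZMod.intCast_surjective (σ g 0)
    have key : ∀ z : ZMod (Fintype.card X), σ g z = j * z + σ g 0 := by
      intro z
      obtain ⟨z, rfl⟩ := ZMod.intCast_surjective z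
      have h0 : ρ g x₀ = (ρ c ^ w) x₀ := by
        rw [← he, hw, hσ, ← Int.cast_zero, he, zpow_zero, Equiv.Perm.one_apply]
      apply e.injective
      rw [hσ, ← hw, ← Int.cast_mul, ← Int.cast_add, he, he, zpow_add, Equiv.Perm.mul_apply, ← h0,
        zpow_mul, ← map_zpow _ c j, hj, ← map_zpow, ← map_zpow, conj_zpow, ← Equiv.Perm.mul_apply,
        ← Equiv.Perm.mul_apply, ← map_mul, ← map_mul, inv_mul_cancel_right]
    have hAj : A g = j := by
      change σ g 1 - σ g 0 = j
      rw [key 1, mul_one, add_sub_cancel_right]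
    intro z
    rw [hAj, key z]
  let a : G →* (ZMod (Fintype.card X))ˣ := MonoidHom.toHomUnits
    { toFun := A
      map_one' := by
        change σ 1 1 - σ 1 0 = 1
        rw [map_one σ, Equiv.Perm.one_apply, Equiv.Perm.one_apply, sub_zero]
      map_mul' := fun g h => by
        change σ (g * h) 1 - σ (g * h) 0 = A g * A h
        rw [map_mul, Equiv.Perm.mul_apply, Equiv.Perm.mul_apply, hA g, hA g (σ h 0)]
        change _ = A g * (σ h 1 - σ h 0)
        ring }
  have hc : ∀ z, σ c z = z + 1 := by
    intro z
    obtain ⟨z, rfl⟩ := ZMod.intCast_surjective z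
    apply e.injective
    rw [hσ, he, ← Int.cast_one, ← Int.cast_add, he, add_comm z, zpow_one_add, Equiv.Perm.mul_apply]
  have hac : a c = 1 := Units.ext (by
    change σ c 1 - σ c 0 = 1
    rw [hc, hc]
    ring)
  refine ⟨e, σ, a, fun g => σ g 0, hσ, hA, ⟨k, fun g => ?_⟩, c, hac, by rw [hc, zero_add]⟩
  obtain ⟨m, hm⟩ := Subgroup.mem_zpowers_iff.1 ((Subgroup.zpowers c).pow_index_mem g)
  rw [← map_pow, ← hk, ← hm, map_zpow, hac, one_zpow]

end CyclicAction

section HypGood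

theorem defect_mem_P_of_isHyp {G : Type} [Group G] [Fintype G] (hG : IsHyp G)
    (ihG : ∀ M : Subgroup G, M ≠ ⊤ → AllGood M) : AllGood G := by
  obtain ⟨C, hN, hc, ho, k, hk⟩ := hG
  obtain ⟨c, rfl⟩ := (Subgroup.isCyclic_iff_exists_zpowers_eq_top C).1 hc
  intro X _ ρ
  induction hn : Fintype.card X using Nat.strong_induction_on generalizing X with
  | _ n ih =>
  have ih' : ∀ (Y : Type) [Fintype Y] (σ : G →* Equiv.Perm Y),
      Fintype.card Y < Fintype.card X → defect σ ∈ P G :=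
    fun Y _ σ hY => ih _ (hn ▸ hY) Y σ rfl
  clear ih
  subst hn
  rcases isEmpty_or_nonempty X with hX | ⟨⟨x₀⟩⟩
  · exact defect_mem_P_of_subsingleton ρ
  by_cases htr : ∀ x, ∃ g, ρ g x₀ = x
  swap
  · exact defect_mem_P_of_not_transitive ρ x₀ htr ih'
  by_cases hsup : stab ρ x₀ ⊔ Subgroup.zpowers c = ⊤
  swap
  · obtain ⟨η, hη, hne⟩ := exists_character hk hsup
    exact defect_mem_P_of_character ρ x₀ htr η hη hne ihG
  have : Nonempty X := ⟨x₀⟩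
  have : NeZero (Fintype.card X) := ⟨Fintype.card_ne_zero⟩
  have hτ : ∀ x, ∃ k : ℤ, ((ρ c) ^ k) x₀ = x := by
    intro x
    obtain ⟨g, rfl⟩ := htr x
    have hg : g ∈ Subgroup.zpowers c ⊔ stab ρ x₀ := by
      rw [sup_comm, hsup]
      exact Subgroup.mem_top g
    obtain ⟨y, hy, z, hz, rfl⟩ := Subgroup.mem_sup_of_normal_left.1 hg
    obtain ⟨m, rfl⟩ := Subgroup.mem_zpowers_iff.1 hy
    exact ⟨m, by rw [map_mul, Equiv.Perm.mul_apply, mem_stab.1 hz, map_zpow]⟩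
  obtain ⟨e, σ, a, b, he, hσ⟩ := exists_isAffine ρ x₀ c hN hk hτ
  rw [← defect_congr e he]
  refine hσ.defect_mem_P_of_odd (ho.of_dvd_nat ?_) ihG ih'
  rw [← Int.natCast_dvd_natCast, ← Finset.card_univ,
    ← (isCycleOn_of_forall_exists hτ).zpow_apply_eq (Finset.mem_univ x₀), zpow_natCast, ← map_pow,
    Nat.card_zpowers, pow_orderOf_eq_one, map_one, Equiv.Perm.one_apply]

theorem allGood_of_isHyp (G : Type) [Group G] [Fintype G] (hG : IsHyp G) : AllGood G := by
  induction hn : Fintype.card G using Nat.strong_induction_on generalizing G with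
  | _ n ih =>
  refine defect_mem_P_of_isHyp hG fun M hM => ih _ ?_ M
    (hG.of_injective M.subtype M.subtype_injective) rfl
  rw [← hn, ← Nat.card_eq_fintype_card, ← Nat.card_eq_fintype_card]
  exact lt_of_not_ge fun h => hM (Subgroup.eq_top_of_le_card M h)

end HypGood

section FixedPoints

variable {G : Type} [Group G] [Finite G]

theorem exists_overgroup_of_two_power_index {C N : Subgroup G} (hCN : C ≤ N)
    (hN : (C.subgroupOf N).Normal) :
    ∃ H : Subgroup G, C ≤ H ∧ H ≤ N ∧ (∃ k, C.relIndex H = 2 ^ k) ∧ Odd (H.relIndex N) := by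
  let C₀ := C.subgroupOf N
  obtain ⟨S⟩ : Nonempty (Sylow 2 (N ⧸ C₀)) := inferInstance
  let H₀ : Subgroup N := (S : Subgroup (N ⧸ C₀)).comap (QuotientGroup.mk' C₀)
  have hC₀ : C₀ = (⊥ : Subgroup (N ⧸ C₀)).comap (QuotientGroup.mk' C₀) := by
    rw [MonoidHom.comap_bot, QuotientGroup.ker_mk']
  have hle : H₀.map N.subtype ≤ N := Subgroup.map_subtype_le H₀
  have hH₀ : (H₀.map N.subtype).subgroupOf N = H₀ :=
    Subgroup.comap_map_eq_self_of_injective N.subtype_injective H₀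
  refine ⟨H₀.map N.subtype, ?_, hle, ?_, ?_⟩
  · intro x hx
    refine ⟨⟨x, hCN hx⟩, ?_, rfl⟩
    have : (⟨x, hCN hx⟩ : N) ∈ C₀ := hx
    rw [hC₀] at this
    exact Subgroup.comap_mono bot_le this
  · obtain ⟨k, hk⟩ := IsPGroup.iff_card.1 S.2
    refine ⟨k, ?_⟩
    rw [← Subgroup.relIndex_subgroupOf hle, hH₀]
    change C₀.relIndex H₀ = _
    rw [hC₀, Subgroup.relIndex_comap, Subgroup.map_comap_eq_self_of_surjective
      (QuotientGroup.mk'_surjective _), Subgroup.relIndex_bot_left]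
    exact hk
  · rw [Subgroup.relIndex, hH₀, Subgroup.index_comap_of_surjective _
      (QuotientGroup.mk'_surjective _), ← Nat.not_even_iff_odd, even_iff_two_dvd]
    exact S.not_dvd_index

theorem card_fixed_modEq {X : Type} [Fintype X] (τ : Equiv.Perm X) (r : ℕ) :
    Fintype.card {x // τ x = x} ≡ Fintype.card {x // (τ ^ 2 ^ r) x = x} [MOD 2] := by
  have hS : ∀ x, (τ ^ 2 ^ r) (τ x) = τ x ↔ (τ ^ 2 ^ r) x = x := fun x => by
    rw [← Equiv.Perm.mul_apply, (Commute.pow_self τ _).eq, Equiv.Perm.mul_apply,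
      EmbeddingLike.apply_eq_iff_eq]
  let σ : Equiv.Perm {x // (τ ^ 2 ^ r) x = x} := τ.subtypePerm hS
  have hσ : σ ^ 2 ^ r = 1 := by
    ext x
    rw [Equiv.Perm.subtypePerm_pow, Equiv.Perm.subtypePerm_apply]
    exact x.2
  have hfix : ∀ x, τ x = x → (τ ^ 2 ^ r) x = x := fun x hx =>
    Equiv.Perm.pow_apply_eq_self_of_apply_eq_self hx _
  have h := Equiv.Perm.card_compl_support_modEq hσ
  have hc : σ.supportᶜ.card = Fintype.card {x // τ x = x} := by
    rw [← Fintype.card_congr (Equiv.subtypeSubtypeEquivSubtype (fun {x} => hfix x)),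
      Fintype.card_subtype]
    congr 1
    ext x
    simp [σ, Subtype.ext_iff]
  rwa [hc] at h

theorem exists_isHyp_odd_card_fixed (g : G) :
    ∃ H : Subgroup G, IsHyp H ∧ Odd (Nat.card {y : G ⧸ H // g • y = y}) := by
  obtain ⟨r, m, hm, hg⟩ := Nat.exists_eq_two_pow_mul_odd (orderOf_pos g).ne'
  set c := g ^ 2 ^ r with hc
  have hoc : Odd (orderOf c) := by
    have : orderOf c ∣ m := orderOf_dvd_of_pow_eq_one (by
      rw [hc, ← pow_mul, ← hg, pow_orderOf_eq_one])
    exact hm.of_dvd_nat this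
  set C := Subgroup.zpowers c with hC
  set N := Subgroup.normalizer (C : Set G) with hNdef
  have hCN : C ≤ N := Subgroup.le_normalizer
  obtain ⟨H, hCH, hHN, ⟨k, hk⟩, hodd⟩ :=
    exists_overgroup_of_two_power_index hCN Subgroup.normal_in_normalizer
  have hCnorm : (C.subgroupOf H).Normal := (Subgroup.normal_subgroupOf_iff hCH).2
    fun h n hh hn => (Subgroup.mem_normalizer_iff.1 (hHN hn) h).1 hh
  refine ⟨H, ⟨C.subgroupOf H, hCnorm, ?_, ?_, k, hk⟩, ?_⟩
  · exact isCyclic_of_injective (Subgroup.subgroupOfEquivOfLe hCH).toMonoidHom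
      (Subgroup.subgroupOfEquivOfLe hCH).injective
  · rw [Nat.card_congr (Subgroup.subgroupOfEquivOfLe hCH).toEquiv, hC, Nat.card_zpowers]
    exact hoc
  have hmem : ∀ x : G, x⁻¹ * c * x ∈ H → x ∈ N := by
    intro x hx
    set y := x⁻¹ * c * x with hy
    have hyC : y ^ 2 ^ k ∈ C := by
      have := (C.subgroupOf H).pow_index_mem ⟨y, hx⟩
      rw [show (C.subgroupOf H).index = 2 ^ k from hk] at this
      exact this
    have hoy : orderOf y = orderOf c :=
      SemiconjBy.orderOf_eq x (show x * y = c * x by rw [hy]; group)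
    have hyC' : y ∈ C := by
      have h1 : y ∈ Subgroup.zpowers (y ^ 2 ^ k) := by
        rw [mem_zpowers_pow_iff, hoy]
        exact (Nat.coprime_two_left.2 hoc).pow_left k
      exact Subgroup.zpowers_le.2 hyC h1
    rw [← inv_mem_iff]
    refine Subgroup.mem_normalizer_fintype fun n hn => ?_
    obtain ⟨j, rfl⟩ := Subgroup.mem_zpowers_iff.1 hn
    rw [← conj_zpow, inv_inv]
    exact C.zpow_mem hyC' j
  have hF : Nat.card {y : G ⧸ H // c • y = y} = H.relIndex N := by
    have hstab : MulAction.stabilizer N ((1 : G) : G ⧸ H) = H.subgroupOf N := by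
      ext n
      rw [MulAction.mem_stabilizer_iff, Subgroup.mem_subgroupOf]
      change ((n * 1 : G) : G ⧸ H) = _ ↔ _
      rw [eq_comm, QuotientGroup.eq, mul_one, inv_one, one_mul]
    rw [Subgroup.relIndex, ← hstab, MulAction.index_stabilizer, ← Nat.card_coe_set_eq]
    refine Nat.card_congr (Equiv.subtypeEquivRight fun y => ?_)
    obtain ⟨x, rfl⟩ := QuotientGroup.mk_surjective y
    constructor
    · intro h
      have hx : x ∈ N := hmem x (by
        have h' : ((c * x : G) : G ⧸ H) = x := h
        rw [eq_comm, QuotientGroup.eq] at h'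
        rwa [mul_assoc])
      refine ⟨⟨x, hx⟩, ?_⟩
      change ((x * 1 : G) : G ⧸ H) = x
      rw [mul_one]
    · rintro ⟨n, hn⟩
      change ((n * 1 : G) : G ⧸ H) = x at hn
      rw [← hn, mul_one]
      change ((c * n : G) : G ⧸ H) = (n : G)
      rw [eq_comm, QuotientGroup.eq, ← mul_assoc]
      exact hCH ((Subgroup.mem_normalizer_iff''.1 n.2 c).1 (Subgroup.mem_zpowers c))
  have := Fintype.ofFinite (G ⧸ H)
  have h := card_fixed_modEq (MulAction.toPerm g : Equiv.Perm (G ⧸ H)) r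
  have hpow : (MulAction.toPerm g : Equiv.Perm (G ⧸ H)) ^ 2 ^ r = MulAction.toPerm c :=
    (map_pow (MulAction.toPermHom G (G ⧸ H)) g _).symm
  rw [hpow] at h
  simp only [MulAction.toPerm_apply, ← Nat.card_eq_fintype_card] at h
  rw [Nat.odd_iff, h, hF, ← Nat.odd_iff]
  exact hodd

end FixedPoints

section OddMultiple

theorem intCast_mul_mem {G : Type} {A : AddSubgroup (G → ℂ)} {u : G → ℂ} (hu : u ∈ A) (n : ℤ) :
    (fun g => (n : ℂ) * u g) ∈ A := by
  convert A.zsmul_mem hu n using 1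
  funext g
  simp

variable {G : Type} [Group G]

/-- The characters of virtual permutation representations with hyperelementary stabilisers. -/
def hypSpan (G : Type) [Group G] : AddSubgroup (G → ℂ) :=
  AddSubgroup.closure {f | ∃ (Y : Type) (_ : Fintype Y) (ρ : G →* Equiv.Perm Y),
    (∀ y, IsHyp (stab ρ y)) ∧ f = permChar ρ}

theorem permChar_mem_hypSpan {Y : Type} [Fintype Y] {ρ : G →* Equiv.Perm Y}
    (h : ∀ y, IsHyp (stab ρ y)) : permChar ρ ∈ hypSpan G :=
  AddSubgroup.subset_closure ⟨Y, inferInstance, ρ, h, rfl⟩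

/-- The product of two permutation representations. -/
def prodPerm {X Y : Type} (ρ : G →* Equiv.Perm X) (σ : G →* Equiv.Perm Y) :
    G →* Equiv.Perm (X × Y) where
  toFun g := (ρ g).prodCongr (σ g)
  map_one' := by
    ext x <;> simp
  map_mul' g h := by
    ext x <;> simp

theorem permChar_prodPerm {X Y : Type} [Fintype X] [Fintype Y] (ρ : G →* Equiv.Perm X)
    (σ : G →* Equiv.Perm Y) : permChar (prodPerm ρ σ) = permChar ρ * permChar σ := by
  funext g
  rw [Pi.mul_apply, permChar, permChar, permChar, Fintype.sum_mul_sum, Fintype.sum_prod_type]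
  refine Finset.sum_congr rfl fun x _ => Finset.sum_congr rfl fun y _ => ?_
  have h : prodPerm ρ σ g (x, y) = (x, y) ↔ ρ g x = x ∧ σ g y = y := Prod.ext_iff
  by_cases hx : ρ g x = x <;> by_cases hy : σ g y = y <;> simp [h, hx, hy]

theorem mul_mem_hypSpan {u v : G → ℂ} (hu : u ∈ hypSpan G) (hv : v ∈ hypSpan G) :
    u * v ∈ hypSpan G := by
  induction hu, hv using AddSubgroup.closure_induction₂ with
  | mem u v hu hv =>
    obtain ⟨X, _, ρ, hρ, rfl⟩ := hu
    obtain ⟨Y, _, σ, -, rfl⟩ := hv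
    rw [← permChar_prodPerm]
    refine permChar_mem_hypSpan fun z => (hρ z.1).of_injective (Subgroup.inclusion fun g hg => ?_)
      (Subgroup.inclusion_injective _)
    exact congrArg Prod.fst (mem_stab.1 hg)
  | zero_left => simp
  | zero_right => simp
  | add_left u v w _ _ _ h h' => simpa only [add_mul] using (hypSpan G).add_mem h h'
  | add_right u v w _ _ _ h h' => simpa only [mul_add] using (hypSpan G).add_mem h h'
  | neg_left u v _ _ h => simpa only [neg_mul] using (hypSpan G).neg_mem h
  | neg_right u v _ _ h => simpa only [mul_neg] using (hypSpan G).neg_mem h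

theorem exists_mem_hypSpan_apply_odd [Finite G] (g : G) :
    ∃ u ∈ hypSpan G, ∃ n : ℤ, Odd n ∧ u g = n := by
  obtain ⟨H, hH, hodd⟩ := exists_isHyp_odd_card_fixed g
  have := Fintype.ofFinite (G ⧸ H)
  refine ⟨permChar (MulAction.toPermHom G (G ⧸ H)), permChar_mem_hypSpan fun y => ?_,
    Nat.card {y : G ⧸ H // g • y = y}, by exact_mod_cast hodd, ?_⟩
  · obtain ⟨x, rfl⟩ := QuotientGroup.mk_surjective y
    refine hH.of_injective (((MulAut.conj x⁻¹).toMonoidHom.comp (Subgroup.subtype _)).codRestrict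
      H fun s => ?_) fun s t hst => ?_
    · have hs : (((s : G) * x : G) : G ⧸ H) = x := mem_stab.1 s.2
      rw [eq_comm, QuotientGroup.eq, ← mul_assoc] at hs
      simpa using hs
    · exact Subtype.ext ((MulAut.conj x⁻¹).injective (congrArg (Subtype.val : H → G) hst))
  · simp [permChar, Nat.card_eq_fintype_card, Fintype.card_subtype]

theorem exists_odd_mem_hypSpan (G : Type) [Group G] [Fintype G] :
    ∃ n : ℤ, Odd n ∧ (fun _ => (n : ℂ)) ∈ hypSpan G := by
  choose u hu n hn hun using exists_mem_hypSpan_apply_odd (G := G)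
  obtain ⟨m, hm, hmem⟩ : ∃ m : ℤ, Odd m ∧
      (∏ g : G, (u g - fun _ => (n g : ℂ)) : G → ℂ) - (fun _ => (m : ℂ)) ∈ hypSpan G := by
    refine Finset.prod_induction (fun g => u g - fun _ => (n g : ℂ))
      (fun v => ∃ m : ℤ, Odd m ∧ v - (fun _ => (m : ℂ)) ∈ hypSpan G) ?_ ?_ ?_
    · rintro v w ⟨k, hk, hv⟩ ⟨l, hl, hw⟩
      refine ⟨k * l, hk.mul hl, ?_⟩
      convert (hypSpan G).add_mem (mul_mem_hypSpan hv hw)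
        ((hypSpan G).add_mem (intCast_mul_mem hv l) (intCast_mul_mem hw k)) using 1
      funext g
      simp only [Pi.sub_apply, Pi.add_apply, Pi.mul_apply]
      push_cast
      ring
    · refine ⟨1, odd_one, ?_⟩
      convert (hypSpan G).zero_mem using 1
      funext g
      simp
    · intro g _
      refine ⟨-n g, (hn g).neg, ?_⟩
      convert hu g using 1
      funext x
      simp
  refine ⟨-m, hm.neg, ?_⟩
  convert hmem using 1
  funext g
  rw [Pi.sub_apply, Finset.prod_apply, Finset.prod_eq_zero (Finset.mem_univ g)]
  · simp
  · rw [Pi.sub_apply, hun, sub_self]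

end OddMultiple

section Multiplication

variable {G : Type} [Group G]

theorem defect_conj {X : Type} [Fintype X] (ρ : G →* Equiv.Perm X) (x g : G) :
    defect ρ (x⁻¹ * g * x) = defect ρ g := by
  have h : permChar ρ (x⁻¹ * g * x) = permChar ρ g := by
    rw [permChar, permChar]
    refine Fintype.sum_equiv (ρ x) _ _ fun y => ?_
    rw [map_mul, map_mul, map_inv, Equiv.Perm.mul_apply, Equiv.Perm.mul_apply,
      Equiv.Perm.inv_eq_iff_eq]
  have h' : sgn ρ (x⁻¹ * g * x) = sgn ρ g := by
    rw [map_mul, map_mul, mul_right_comm, ← map_mul, inv_mul_cancel, map_one, one_mul]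
  rw [defect, defect, h, lin, lin, h']

variable [Fintype G]

theorem indChar_permChar_mul {Y : Type} [Fintype Y] (σ : G →* Equiv.Perm Y) (y₀ : Y)
    (htr : ∀ y, ∃ g, σ g y₀ = y) {f : G → ℂ} (hf : ∀ x g, f (x⁻¹ * g * x) = f g) :
    indChar (stab σ y₀) (fun h => f h) = permChar σ * f := by
  have h := (isFib_self htr (M := stab σ y₀) fun _ => Iff.rfl).indChar_permChar
  funext g
  rw [Pi.mul_apply, ← h, indChar_apply, indChar_apply, mul_assoc, Finset.sum_mul]
  congr 1
  refine Finset.sum_congr rfl fun x _ => ?_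
  by_cases hx : x⁻¹ * g * x ∈ stab σ y₀
  · rw [extendZero_of_mem _ hx, extendZero_of_mem _ hx, hf]
    simp [permChar]
  · rw [extendZero_of_notMem _ hx, extendZero_of_notMem _ hx, zero_mul]

theorem permChar_mul_mem_P {f : G → ℂ} (hf : ∀ x g, f (x⁻¹ * g * x) = f g)
    (hP : ∀ H : Subgroup G, IsHyp H → (fun h : H => f h) ∈ P H) {Y : Type} [Fintype Y]
    (σ : G →* Equiv.Perm Y) (hσ : ∀ y, IsHyp (stab σ y)) : permChar σ * f ∈ P G := by
  induction hn : Fintype.card Y using Nat.strong_induction_on generalizing Y with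
  | _ n ih =>
  rcases isEmpty_or_nonempty Y with hY | ⟨⟨y₀⟩⟩
  · have : permChar σ * f = 0 := by
      funext g
      simp [permChar]
    rw [this]
    exact (P G).zero_mem
  by_cases htr : ∀ y, ∃ g, σ g y₀ = y
  · rw [← indChar_permChar_mul σ y₀ htr hf]
    exact indChar_mem_P _ (hP _ (hσ y₀))
  push Not at htr
  obtain ⟨y₁, hy₁⟩ := htr
  let S : Y → Prop := fun y => ∃ g, σ g y₀ = y
  have hS : ∀ g y, S (σ g y) ↔ S y := orbit_invariant σ y₀
  have hstab : ∀ (T : Y → Prop) (hT : ∀ g y, T (σ g y) ↔ T y) (y : {y // T y}),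
      IsHyp (stab (restrictPerm σ T hT) y) := fun T hT y =>
    (hσ y).of_injective (Subgroup.inclusion fun g hg => congrArg Subtype.val (mem_stab.1 hg))
      (Subgroup.inclusion_injective _)
  rw [permChar_sum (ρ := restrictPerm σ S hS)
    (σ := restrictPerm σ (fun y => ¬ S y) fun g y => not_congr (hS g y)) (Equiv.sumCompl S)
    (fun g x => rfl) (fun g x => rfl), add_mul]
  refine (P G).add_mem (ih _ ?_ _ (hstab _ _) rfl) (ih _ ?_ _ (hstab _ _) rfl)
  · rw [← hn]
    refine Fintype.card_subtype_lt (x := y₁) ?_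
    rintro ⟨g, hg⟩
    exact hy₁ g hg
  · rw [← hn]
    exact Fintype.card_subtype_lt (x := y₀) fun h => h ⟨1, by simp⟩

theorem mul_mem_P_of_mem_hypSpan {u f : G → ℂ} (hu : u ∈ hypSpan G)
    (hf : ∀ x g, f (x⁻¹ * g * x) = f g)
    (hP : ∀ H : Subgroup G, IsHyp H → (fun h : H => f h) ∈ P H) : u * f ∈ P G := by
  induction hu using AddSubgroup.closure_induction with
  | mem u hu =>
    obtain ⟨Y, _, σ, hσ, rfl⟩ := hu
    exact permChar_mul_mem_P hf hP σ hσ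
  | zero => simp
  | add u v _ _ h h' => simpa only [add_mul] using (P G).add_mem h h'
  | neg u _ h => simpa only [neg_mul] using (P G).neg_mem h

theorem allGood (G : Type) [Group G] [Fintype G] : AllGood G := by
  intro X _ ρ
  obtain ⟨n, ⟨k, rfl⟩, hmem⟩ := exists_odd_mem_hypSpan G
  have h1 := mul_mem_P_of_mem_hypSpan hmem (defect_conj ρ)
    fun H hH => allGood_of_isHyp H hH X (ρ.comp H.subtype)
  convert (P G).sub_mem h1 (intCast_mul_mem (two_mul_defect_mem_P ρ) k) using 1
  funext g
  simp only [Pi.sub_apply, Pi.mul_apply]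
  push_cast
  ring

end Multiplication

section Eigenvalues

theorem prod_eq_of_sum_pow_eq {I J : Type*} [Fintype I] [Fintype J] (μ : I → ℂ) (ν : J → ℂ)
    (h : ∀ k : ℕ, ∑ i, μ i ^ k = ∑ j, ν j ^ k) : ∏ i, μ i = ∏ j, ν j := by
  have key : ∑ i, Finsupp.single (powersHom ℂ (μ i)) (1 : ℂ) =
      ∑ j, Finsupp.single (powersHom ℂ (ν j)) (1 : ℂ) := by
    apply linearIndependent_monoidHom (Multiplicative ℕ) ℂ
    simp only [map_sum, Finsupp.linearCombination_single, one_smul]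
    funext k
    simpa using h k.toAdd
  have hm : (Finset.univ : Finset I).val.map μ = (Finset.univ : Finset J).val.map ν := by
    refine Multiset.ext.2 fun z => ?_
    have hz := DFunLike.congr_fun key (powersHom ℂ z)
    simp only [Finsupp.finsetSum_apply, Finsupp.single_apply, EmbeddingLike.apply_eq_iff_eq] at hz
    rw [Multiset.count_map, Multiset.count_map]
    simp only [Finset.sum_boole, Nat.cast_inj] at hz
    simp only [@eq_comm ℂ z]
    exact hz
  exact congrArg Multiset.prod hm

theorem exists_eigenvalues {V : Type*} [AddCommGroup V] [Module ℂ V] [FiniteDimensional ℂ V]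
    (φ : Module.End ℂ V) {N : ℕ} (hN : N ≠ 0) (hφ : φ ^ N = 1) :
    ∃ (n : ℕ) (μ : Fin n → ℂ), (∀ k : ℕ, LinearMap.trace ℂ V (φ ^ k) = ∑ i, μ i ^ k) ∧
      LinearMap.det φ = ∏ i, μ i := by
  have hss : φ.IsSemisimple := by
    refine Module.End.isSemisimple_of_squarefree_aeval_eq_zero
      (p := Polynomial.X ^ N - Polynomial.C 1) ?_ (by simp [hφ])
    exact (Polynomial.separable_X_pow_sub_C (1 : ℂ) (Nat.cast_ne_zero.2 hN) one_ne_zero).squarefree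
  let eigenDecomp := DirectSum.isInternal_submodule_of_iSupIndep_of_iSup_eq_top
    φ.eigenspaces_iSupIndep hss.iSup_eigenspace_eq_top
  let v₀ := eigenDecomp.collectedBasis fun μ => Module.finBasis ℂ (φ.eigenspace μ)
  have := FiniteDimensional.fintypeBasisIndex v₀
  let e := Fintype.equivFin ((ν : ℂ) × Fin (Module.finrank ℂ (φ.eigenspace ν)))
  let v := v₀.reindex e
  let μ : Fin _ → ℂ := fun i => (e.symm i).1
  have hv : ∀ i, φ (v i) = μ i • v i := fun i => by
    rw [Module.Basis.reindex_apply]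
    exact Module.End.mem_eigenspace_iff.1 (eigenDecomp.collectedBasis_mem _ _)
  have hvk : ∀ (k : ℕ) i, (φ ^ k) (v i) = μ i ^ k • v i := by
    intro k i
    induction k with
    | zero => simp
    | succ k ih => rw [pow_succ', Module.End.mul_apply, ih, map_smul, hv, smul_smul, pow_succ]
  have hdiag : ∀ k : ℕ, LinearMap.toMatrix v v (φ ^ k) = Matrix.diagonal fun i => μ i ^ k := by
    intro k
    ext i j
    rw [LinearMap.toMatrix_apply, hvk, map_smul, Module.Basis.repr_self, Finsupp.smul_single,
      smul_eq_mul, mul_one, Finsupp.single_apply, Matrix.diagonal_apply]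
    by_cases hij : i = j
    · rw [if_pos hij.symm, if_pos hij, hij]
    · rw [if_neg (Ne.symm hij), if_neg hij]
  refine ⟨_, μ, fun k => ?_, ?_⟩
  · rw [LinearMap.trace_eq_matrix_trace ℂ v, hdiag, Matrix.trace_diagonal]
  · have h1 := hdiag 1
    simp only [pow_one] at h1
    rw [← LinearMap.det_toMatrix v, h1, Matrix.det_diagonal]

variable {G : Type} [Group G] [Finite G]

theorem exists_eigenvalues_rep (V : FDRep ℂ G) (g : G) :
    ∃ (n : ℕ) (μ : Fin n → ℂ), (∀ k : ℕ, V.character (g ^ k) = ∑ i, μ i ^ k) ∧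
      detRep V g = ∏ i, μ i := by
  obtain ⟨n, μ, h1, h2⟩ := exists_eigenvalues (V.ρ g) (orderOf_pos g).ne'
    (by rw [← map_pow, pow_orderOf_eq_one, map_one])
  refine ⟨n, μ, fun k => ?_, h2⟩
  rw [← h1, ← map_pow]
  rfl

theorem detRep_mul_eq {V W V' W' : FDRep ℂ G}
    (h : V.character + W'.character = V'.character + W.character) (g : G) :
    detRep V g * detRep W' g = detRep V' g * detRep W g := by
  obtain ⟨_, μ₁, h₁, hd₁⟩ := exists_eigenvalues_rep V g
  obtain ⟨_, μ₂, h₂, hd₂⟩ := exists_eigenvalues_rep W' g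
  obtain ⟨_, μ₃, h₃, hd₃⟩ := exists_eigenvalues_rep V' g
  obtain ⟨_, μ₄, h₄, hd₄⟩ := exists_eigenvalues_rep W g
  have := prod_eq_of_sum_pow_eq (Sum.elim μ₁ μ₂) (Sum.elim μ₃ μ₄) fun k => by
    simpa [Fintype.sum_sum_type, h₁, h₂, h₃, h₄] using congrFun h (g ^ k)
  simpa [Fintype.prod_sum_type, hd₁, hd₂, hd₃, hd₄] using this

theorem norm_detRep (V : FDRep ℂ G) (g : G) : ‖detRep V g‖ = 1 := by
  refine Complex.norm_eq_one_of_pow_eq_one (n := orderOf g) ?_ (orderOf_pos g).ne'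
  rw [detRep, ← map_pow, ← map_pow, pow_orderOf_eq_one, map_one, map_one]

end Eigenvalues

section Main

variable {G : Type} [Group G]

/-- The disjoint union of two permutation representations. -/
def sumPerm {X Y : Type} (ρ : G →* Equiv.Perm X) (σ : G →* Equiv.Perm Y) :
    G →* Equiv.Perm (X ⊕ Y) :=
  (Equiv.Perm.sumCongrHom X Y).comp (ρ.prod σ)

theorem permChar_sumPerm {X Y : Type} [Fintype X] [Fintype Y] (ρ : G →* Equiv.Perm X)
    (σ : G →* Equiv.Perm Y) : permChar (sumPerm ρ σ) = permChar ρ + permChar σ :=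
  permChar_sum (Equiv.refl _) (fun _ _ => rfl) fun _ _ => rfl

variable [Fintype G]

theorem indChar_one_eq (H : Subgroup G) :
    indChar H 1 = permChar (MulAction.toPermHom G (G ⧸ H)) := by
  have htr : ∀ b : G ⧸ H, ∃ g, MulAction.toPermHom G (G ⧸ H) g ((1 : G) : G ⧸ H) = b := fun b =>
    MulAction.exists_smul_eq G ((1 : G) : G ⧸ H) b
  have hmem : ∀ g, g ∈ H ↔ MulAction.toPermHom G (G ⧸ H) g ((1 : G) : G ⧸ H) = (1 : G) := by
    intro g
    change _ ↔ ((g * 1 : G) : G ⧸ H) = _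
    rw [eq_comm, QuotientGroup.eq, mul_one, inv_one, one_mul]
  rw [← (isFib_self htr hmem).indChar_permChar]
  congr 1
  funext h
  simp [permChar]

theorem _root_.IsPermChar.exists_permChar_sub {f : G → ℂ} (hf : IsPermChar f) :
    ∃ (X Y : Type) (_ : Fintype X) (_ : Fintype Y) (ρ : G →* Equiv.Perm X)
      (σ : G →* Equiv.Perm Y), f = permChar ρ - permChar σ := by
  rw [IsPermChar, ← Submodule.mem_toAddSubgroup, Submodule.span_int_eq_addSubgroupClosure] at hf
  induction hf using AddSubgroup.closure_induction with
  | mem f hf =>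
    obtain ⟨H, rfl⟩ := hf
    refine ⟨G ⧸ H, Empty, inferInstance, inferInstance, MulAction.toPermHom G (G ⧸ H), 1, ?_⟩
    rw [indChar_one_eq]
    funext g
    simp [permChar]
  | zero => exact ⟨Empty, Empty, inferInstance, inferInstance, 1, 1, by simp⟩
  | add u v _ _ hu hv =>
    obtain ⟨X, Y, _, _, ρ, σ, rfl⟩ := hu
    obtain ⟨X', Y', _, _, ρ', σ', rfl⟩ := hv
    refine ⟨X ⊕ X', Y ⊕ Y', inferInstance, inferInstance, sumPerm ρ ρ', sumPerm σ σ', ?_⟩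
    rw [permChar_sumPerm, permChar_sumPerm]
    abel
  | neg u _ hu =>
    obtain ⟨X, Y, _, _, ρ, σ, rfl⟩ := hu
    exact ⟨Y, X, inferInstance, inferInstance, σ, ρ, neg_sub _ _⟩

theorem sgn_eq_of_hasTrivialDet {X Y : Type} [Fintype X] [Fintype Y] {ρ : G →* Equiv.Perm X}
    {σ : G →* Equiv.Perm Y} (h : HasTrivialDet (permChar ρ - permChar σ)) : sgn ρ = sgn σ := by
  obtain ⟨V, W, hVW, hdet⟩ := h
  have hchar : ∀ {Z : Type} [Fintype Z] (τ : G →* Equiv.Perm Z),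
      (matRep (permMat τ)).character = permChar τ := fun τ =>
    funext fun g => (matRep_character _ g).trans (trace_permMat τ g)
  ext g
  have key := detRep_mul_eq (V := matRep (permMat ρ)) (W' := W) (V' := V)
    (W := matRep (permMat σ)) (by
      rw [hchar, hchar, ← sub_eq_sub_iff_add_eq_add, hVW]) g
  have hW := norm_detRep W g
  have hconj : starRingEnd ℂ (detRep W g) * detRep W g = 1 := by
    rw [Complex.conj_mul', hW]
    norm_num
  have hVWg : detRep V g = detRep W g := by
    rw [← mul_one (detRep V g), ← hconj, ← mul_assoc, hdet, one_mul]
  have hW0 : detRep W g ≠ 0 := norm_ne_zero_iff.1 (hW ▸ one_ne_zero)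
  rw [hVWg, mul_comm, matRep_detRep, matRep_detRep, det_permMat, det_permMat] at key
  exact_mod_cast mul_left_cancel₀ hW0 key

end Main

end

end PermChar

/-- **Theorem 2.8.** For every finite group `G` one has `𝒮_G ⊆ 𝒫_G`: every permutation
character of `G` of degree 0 and trivial determinant lies in `𝒫_G`. -/
theorem statement1 (G : Type) [Group G] [Fintype G] : SG G ⊆ PG G := by
  rintro f ⟨hperm, hdeg, hdet⟩
  obtain ⟨X, Y, _, _, ρ, σ, rfl⟩ := hperm.exists_permChar_sub
  have hsgn := PermChar.sgn_eq_of_hasTrivialDet hdet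
  rw [Pi.sub_apply, PermChar.permChar_one, PermChar.permChar_one, sub_eq_zero] at hdeg
  have h := (PermChar.P G).sub_mem (PermChar.allGood G X ρ) (PermChar.allGood G Y σ)
  rw [PermChar.defect_eq, PermChar.defect_eq, hsgn, hdeg, sub_sub_sub_cancel_right,
    sub_sub_sub_cancel_right] at h
  exact h
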